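/- arXiv:2506.03026 — 2 statements merged into one kernel-verified Lean document; each statement's English description precedes it below -/
import Mathlib

section
/- Let σ be a full-dimensional strongly convex rational polyhedral cone of dimension 4 in N ⊗ ℝ (N free of rank 4), whose number of 3-dimensional faces is strictly larger than its number of 1-dimensional faces. Then H²(Ish³_σ) ≠ 0, where Ish³_σ is the degree-zero part of the third Ishida complex: Λ³M_ℝ → ⊕_{μ∈P₁} Λ²μ^⊥ → ⊕_{μ∈P₂} Λ¹μ^⊥ → ⊕_{μ∈P₃} ℝ. -/
open Module

/-- A subset of `ℝⁿ` is a rational polyhedral cone if it is the set of nonnegative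
combinations of finitely many lattice vectors. -/
def IsRatPolyhedralCone {n : ℕ} (σ : Set (Fin n → ℝ)) : Prop :=
  ∃ S : Finset (Fin n → ℤ),
    σ = {x | ∃ c : (Fin n → ℤ) → ℝ, (∀ s, 0 ≤ c s) ∧
          x = ∑ s ∈ S, c s • (fun i => ((s i : ℝ)))}

/-- A cone is strongly convex if it contains no line. -/
def IsStronglyConvex {n : ℕ} (σ : Set (Fin n → ℝ)) : Prop :=
  ∀ x ∈ σ, -x ∈ σ → x = 0

/-- `F` is a face of `σ` if it is the zero locus on `σ` of a linear functional
that is nonnegative on `σ`. -/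
def IsFaceOf {n : ℕ} (σ F : Set (Fin n → ℝ)) : Prop :=
  ∃ u : (Fin n → ℝ) →ₗ[ℝ] ℝ, (∀ x ∈ σ, 0 ≤ u x) ∧ F = {x | x ∈ σ ∧ u x = 0}

/-- The dimension of a face: the dimension of its linear span. -/
noncomputable def faceDim {n : ℕ} (F : Set (Fin n → ℝ)) : ℕ :=
  Module.finrank ℝ (Submodule.span ℝ F)

theorem test : True := trivial

/-- `Λ^k μ^⊥`, realised as the space of alternating `k`-forms on `ℝⁿ` that vanish whenever
one of their arguments lies in the linear span of `μ`. -/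
noncomputable def Ann {n : ℕ} (μ : Set (Fin n → ℝ)) (k : ℕ) :
    Submodule ℝ ((Fin n → ℝ) [⋀^Fin k]→ₗ[ℝ] ℝ) where
  carrier := {ω | ∀ v : Fin k → (Fin n → ℝ), (∃ i, v i ∈ Submodule.span ℝ μ) → ω v = 0}
  add_mem' := by
    intro a b ha hb v hv
    simp [ha v hv, hb v hv]
  zero_mem' := by
    intro v hv
    rfl
  smul_mem' := by
    intro c a ha v hv
    simp [ha v hv]


/-- `σ` is the set of nonnegative combinations of finitely many vectors. -/
def IsFGCone {n : ℕ} (σ : Set (Fin n → ℝ)) : Prop :=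
  ∃ T : Finset (Fin n → ℝ),
    σ = {x | ∃ c : (Fin n → ℝ) → ℝ, (∀ s, 0 ≤ c s) ∧ x = ∑ s ∈ T, c s • s}

theorem IsRatPolyhedralCone.isFGCone {n : ℕ} {σ : Set (Fin n → ℝ)}
    (h : IsRatPolyhedralCone σ) : IsFGCone σ := by
  classical
  obtain ⟨S, rfl⟩ := h
  have hinj : Function.Injective (fun (s : Fin n → ℤ) (i : Fin n) => (s i : ℝ)) := by
    intro s t hst
    funext i
    have := congrFun hst i
    dsimp only at this
    exact_mod_cast this
  refine ⟨S.image (fun s i => (s i : ℝ)), ?_⟩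
  ext x
  constructor
  · rintro ⟨c, hc, rfl⟩
    refine ⟨fun t => c (fun i => ⌊t i⌋), fun s => hc _, ?_⟩
    rw [Finset.sum_image hinj.injOn]
    simp
  · rintro ⟨c, hc, rfl⟩
    refine ⟨fun s => c (fun i => s i), fun s => hc _, ?_⟩
    rw [Finset.sum_image hinj.injOn]

/-- A finitely generated cone contains a finite set of generators, and every functional that is
nonnegative on the generators is nonnegative on the cone. -/
theorem IsFGCone.exists_generators {n : ℕ} {σ : Set (Fin n → ℝ)} (h : IsFGCone σ) :
    ∃ T : Finset (Fin n → ℝ), (∀ s ∈ T, s ∈ σ) ∧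
      ∀ u : (Fin n → ℝ) →ₗ[ℝ] ℝ, (∀ s ∈ T, 0 ≤ u s) → ∀ x ∈ σ, 0 ≤ u x := by
  classical
  obtain ⟨T, rfl⟩ := h
  refine ⟨T, fun s hs => ⟨fun t => if t = s then 1 else 0, fun t => ?_, ?_⟩, ?_⟩
  · dsimp only
    split_ifs <;> simp
  · simp [hs]
  · rintro u hu x ⟨c, hc, rfl⟩
    rw [map_sum]
    refine Finset.sum_nonneg fun s hs => ?_
    rw [map_smul]
    exact mul_nonneg (hc s) (hu s hs)

theorem IsFaceOf.subset {n : ℕ} {σ F : Set (Fin n → ℝ)} (h : IsFaceOf σ F) : F ⊆ σ := by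
  obtain ⟨u, -, rfl⟩ := h
  exact fun x hx => hx.1

theorem IsFaceOf.refl {n : ℕ} (σ : Set (Fin n → ℝ)) : IsFaceOf σ σ :=
  ⟨0, by simp, by simp⟩

theorem IsFaceOf.of_subset {n : ℕ} {σ F G : Set (Fin n → ℝ)} (hG : IsFaceOf σ G)
    (hF : F ⊆ σ) (hGF : G ⊆ F) : IsFaceOf F G := by
  obtain ⟨u, hu, rfl⟩ := hG
  exact ⟨u, fun x hx => hu x (hF hx), Set.ext fun x =>
    ⟨fun hx => ⟨hGF hx, hx.2⟩, fun hx => ⟨hF hx.1, hx.2⟩⟩⟩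

theorem IsFaceOf.isFGCone {n : ℕ} {σ F : Set (Fin n → ℝ)} (hF : IsFaceOf σ F)
    (hσ : IsFGCone σ) : IsFGCone F := by
  classical
  obtain ⟨u, hu, rfl⟩ := hF
  obtain ⟨T, hT⟩ := hσ
  have hTσ : ∀ s ∈ T, s ∈ σ := fun s hs => by
    rw [hT]
    refine ⟨fun t => if t = s then 1 else 0, fun t => ?_, by simp [hs]⟩
    dsimp only
    split_ifs <;> simp
  refine ⟨T.filter (fun s => u s = 0), Set.ext fun x => ⟨?_, ?_⟩⟩
  · rintro ⟨hx, hux⟩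
    rw [hT] at hx
    obtain ⟨c, hc, rfl⟩ := hx
    refine ⟨c, hc, ?_⟩
    rw [Finset.sum_filter]
    refine Finset.sum_congr rfl fun s hs => ?_
    split_ifs with h
    · rfl
    · rw [map_sum, Finset.sum_eq_zero_iff_of_nonneg] at hux
      · have := hux s hs
        rw [map_smul, smul_eq_mul, mul_eq_zero] at this
        rw [this.resolve_right h, zero_smul]
      · intro t ht
        rw [map_smul]
        exact mul_nonneg (hc t) (hu t (hTσ t ht))
  · rintro ⟨c, hc, rfl⟩
    refine ⟨?_, ?_⟩
    · rw [hT]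
      refine ⟨fun s => if u s = 0 then c s else 0, fun s => ?_, ?_⟩
      · dsimp only
        split_ifs
        exacts [hc s, le_rfl]
      · rw [Finset.sum_filter]
        refine Finset.sum_congr rfl fun s hs => ?_
        split_ifs <;> simp [*]
    · rw [map_sum]
      refine Finset.sum_eq_zero fun s hs => ?_
      rw [map_smul, (Finset.mem_filter.1 hs).2, smul_zero]

/-- A face of a face of a finitely generated cone is a face. -/
theorem IsFaceOf.trans {n : ℕ} {σ F G : Set (Fin n → ℝ)} (hσ : IsFGCone σ)
    (hF : IsFaceOf σ F) (hG : IsFaceOf F G) : IsFaceOf σ G := by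
  obtain ⟨u, hu, rfl⟩ := hF
  obtain ⟨f, hf, rfl⟩ := hG
  obtain ⟨T, hTσ, hT⟩ := hσ.exists_generators
  set N : ℝ := ∑ s ∈ T, |f s| / u s with hN
  have key : ∀ x ∈ σ, 0 ≤ (f + N • u) x := by
    refine hT _ fun s hs => ?_
    rcases (hu s (hTσ s hs)).eq_or_lt with h | h
    · simpa [← h] using hf s ⟨hTσ s hs, h.symm⟩
    · have h1 : |f s| / u s ≤ N :=
        Finset.single_le_sum (f := fun s => |f s| / u s)
          (fun t ht => div_nonneg (abs_nonneg _) (hu t (hTσ t ht))) hs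
      rw [div_le_iff₀ h] at h1
      have := neg_abs_le (f s)
      simp only [LinearMap.add_apply, LinearMap.smul_apply, smul_eq_mul]
      linarith
  refine ⟨f + N • u + u, fun x hx => add_nonneg (key x hx) (hu x hx), Set.ext fun x => ?_⟩
  constructor
  · rintro ⟨⟨hx, hux⟩, hfx⟩
    exact ⟨hx, by simp [hux, hfx]⟩
  · rintro ⟨hx, h⟩
    have h1 := key x hx
    have h2 := hu x hx
    rw [LinearMap.add_apply] at h
    have h3 : u x = 0 := by linarith
    refine ⟨⟨hx, h3⟩, ?_⟩
    simpa [h3] using h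

theorem eq_zero_of_mem_span {n : ℕ} {F : Set (Fin n → ℝ)} {u : (Fin n → ℝ) →ₗ[ℝ] ℝ}
    (hu : ∀ x ∈ F, u x = 0) {x : Fin n → ℝ} (hx : x ∈ Submodule.span ℝ F) : u x = 0 :=
  (Submodule.span_le (p := LinearMap.ker u)).2 hu hx

theorem IsFaceOf.faceDim_lt {n : ℕ} {σ G : Set (Fin n → ℝ)} (hG : IsFaceOf σ G)
    (hne : G ≠ σ) : faceDim G < faceDim σ := by
  have hsub := hG.subset
  obtain ⟨u, hu, h⟩ := hG
  refine Submodule.finrank_lt_finrank_of_lt (lt_of_le_of_ne (Submodule.span_mono hsub) ?_)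
  intro heq
  refine hne (hsub.antisymm fun x hx => ?_)
  have h0 : u x = 0 := by
    refine eq_zero_of_mem_span (F := G) ?_ (heq ▸ Submodule.subset_span hx)
    intro y hy
    rw [h] at hy
    exact hy.2
  rw [h]
  exact ⟨hx, h0⟩

theorem IsFaceOf.eq_of_subset {n : ℕ} {σ F G : Set (Fin n → ℝ)} (hF : IsFaceOf σ F)
    (hG : IsFaceOf σ G) (h : G ⊆ F) (hdim : faceDim F ≤ faceDim G) : G = F := by
  by_contra hne
  exact absurd ((hG.of_subset hF.subset h).faceDim_lt hne) (not_lt.2 hdim)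

/-- The extremal member of a pencil of functionals `g + l • w`, where `w` exposes a face. -/
theorem IsFGCone.exists_pencil {n : ℕ} {σ : Set (Fin n → ℝ)} (hσ : IsFGCone σ)
    (g w : (Fin n → ℝ) →ₗ[ℝ] ℝ) (hw : ∀ x ∈ σ, 0 ≤ w x) (hg : ∀ x ∈ σ, w x = 0 → g x = 0)
    (hne : ∃ x ∈ σ, w x ≠ 0) :
    ∃ l : ℝ, (∀ x ∈ σ, 0 ≤ g x + l * w x) ∧ ∃ y ∈ σ, w y ≠ 0 ∧ g y + l * w y = 0 := by
  classical
  obtain ⟨T, hTσ, hT⟩ := hσ.exists_generators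
  have hnon : (T.filter (fun s => w s ≠ 0)).Nonempty := by
    by_contra hemp
    rw [Finset.not_nonempty_iff_eq_empty, Finset.filter_eq_empty_iff] at hemp
    obtain ⟨x, hx, hwx⟩ := hne
    have h1 := hw x hx
    have h2 := hT (-w) (fun s hs => by simp [not_not.1 (hemp hs)]) x hx
    rw [LinearMap.neg_apply] at h2
    exact hwx (by linarith)
  obtain ⟨y, hy, hmin⟩ := Finset.exists_min_image _ (fun s => g s / w s) hnon
  obtain ⟨hyT, hwy⟩ := Finset.mem_filter.1 hy
  refine ⟨-(g y / w y), ?_, y, hTσ y hyT, hwy, by field_simp; ring⟩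
  refine hT (g + (-(g y / w y)) • w) fun s hs => ?_
  simp only [LinearMap.add_apply, LinearMap.smul_apply, smul_eq_mul]
  by_cases hws : w s = 0
  · simp [hws, hg s (hTσ s hs) hws]
  · have hpos : 0 < w s := lt_of_le_of_ne (hw s (hTσ s hs)) (Ne.symm hws)
    have := hmin s (Finset.mem_filter.2 ⟨hs, hws⟩)
    rw [le_div_iff₀ hpos] at this
    linarith

theorem IsFaceOf.of_pencil {n : ℕ} {σ : Set (Fin n → ℝ)} {g w : (Fin n → ℝ) →ₗ[ℝ] ℝ} {l : ℝ}
    (h : ∀ x ∈ σ, 0 ≤ g x + l * w x) : IsFaceOf σ {x | x ∈ σ ∧ g x + l * w x = 0} :=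
  ⟨g + l • w, by simpa using h, by simp⟩

theorem IsFaceOf.exists_covering_aux {n : ℕ} (d : ℕ) : ∀ {σ G : Set (Fin n → ℝ)}, faceDim σ ≤ d →
    IsFGCone σ → IsFaceOf σ G → G ≠ σ →
    ∃ τ, IsFaceOf σ τ ∧ G ⊆ τ ∧ faceDim τ = faceDim G + 1 := by
  induction d with
  | zero =>
    intro σ G hd _ hG hne
    have := hG.faceDim_lt hne
    omega
  | succ d ih =>
    intro σ G hd hσ hG hne
    have hlt := hG.faceDim_lt hne
    rcases Nat.eq_or_lt_of_le (Nat.succ_le_of_lt hlt) with heq | hlt2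
    · exact ⟨σ, IsFaceOf.refl σ, hG.subset, heq.symm⟩
    have hGσ := hG.subset
    have hG' := hG
    obtain ⟨w, hw, hGw⟩ := hG'
    have hmemG : ∀ x ∈ σ, w x = 0 → x ∈ G := fun x hx h => by rw [hGw]; exact ⟨hx, h⟩
    have hwG : ∀ x ∈ G, w x = 0 := fun x hx => by rw [hGw] at hx; exact hx.2
    obtain ⟨x, hxσ, hxG⟩ : ∃ x ∈ σ, x ∉ G := by
      by_contra! hcon
      exact hne (hGσ.antisymm hcon)
    have hdim : finrank ℝ ↥(Submodule.span ℝ G ⊔ Submodule.span ℝ {x}) <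
        finrank ℝ (Submodule.span ℝ σ) := by
      have h1 := Submodule.finrank_add_le_finrank_add_finrank (Submodule.span ℝ G)
        (Submodule.span ℝ {x})
      have h2 := finrank_span_le_card (R := ℝ) ({x} : Set (Fin n → ℝ))
      simp only [Set.toFinset_singleton, Finset.card_singleton] at h2
      unfold faceDim at hlt2
      omega
    obtain ⟨y, hyσ, hy⟩ : ∃ y ∈ σ, y ∉ Submodule.span ℝ G ⊔ Submodule.span ℝ {x} := by
      by_contra! hcon
      exact absurd (Submodule.finrank_mono (Submodule.span_le.2 hcon)) (not_le.2 hdim)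
    obtain ⟨g, hgy, hg⟩ := Submodule.exists_le_ker_of_notMem hy
    have hgG : ∀ z ∈ G, g z = 0 := fun z hz =>
      hg (Submodule.mem_sup_left (Submodule.subset_span hz))
    have hgx : g x = 0 :=
      hg (Submodule.mem_sup_right (Submodule.mem_span_singleton_self x))
    obtain ⟨l, hl, z, hzσ, hwz, hz⟩ := hσ.exists_pencil g w hw
      (fun z hz h => hgG z (hmemG z hz h)) ⟨x, hxσ, fun h => hxG (hmemG x hxσ h)⟩
    have hF := IsFaceOf.of_pencil hl
    set F := {x | x ∈ σ ∧ g x + l * w x = 0}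
    have hFne : F ≠ σ := by
      intro h
      have hx0 : g x + l * w x = 0 := (show x ∈ F from h ▸ hxσ).2
      have hy0 : g y + l * w y = 0 := (show y ∈ F from h ▸ hyσ).2
      rw [hgx, zero_add, mul_eq_zero] at hx0
      rw [hx0.resolve_right fun h => hxG (hmemG x hxσ h)] at hy0
      exact hgy (by simpa using hy0)
    have hGF : G ⊆ F := fun t ht => ⟨hGσ ht, by simp [hgG t ht, hwG t ht]⟩
    obtain ⟨τ, hτ, hGτ, hτd⟩ := ih (by have := hF.faceDim_lt hFne; omega) (hF.isFGCone hσ)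
      (hG.of_subset hF.subset hGF) (fun h => hwz (hwG z (h ▸ ⟨hzσ, hz⟩)))
    exact ⟨τ, hF.trans hσ hτ, hGτ, hτd⟩

/-- A proper face of a finitely generated cone lies in a face of dimension one larger. -/
theorem IsFaceOf.exists_covering {n : ℕ} {σ G : Set (Fin n → ℝ)} (hG : IsFaceOf σ G)
    (hσ : IsFGCone σ) (hne : G ≠ σ) :
    ∃ τ, IsFaceOf σ τ ∧ G ⊆ τ ∧ faceDim τ = faceDim G + 1 :=
  IsFaceOf.exists_covering_aux _ le_rfl hσ hG hne

/-- A functional vanishing on a face `G` is nonnegative on the cone as soon as it is nonnegative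
on the faces covering `G`. -/
theorem IsFaceOf.nonneg_of_covering {n : ℕ} {σ G : Set (Fin n → ℝ)} (hG : IsFaceOf σ G)
    (hσ : IsFGCone σ) (g : (Fin n → ℝ) →ₗ[ℝ] ℝ) (hg : ∀ x ∈ G, g x = 0)
    (hcov : ∀ τ, IsFaceOf σ τ → G ⊆ τ → faceDim τ = faceDim G + 1 → ∀ x ∈ τ, 0 ≤ g x) :
    ∀ x ∈ σ, 0 ≤ g x := by
  by_contra! hcon
  obtain ⟨x, hxσ, hgx⟩ := hcon
  have hGσ := hG.subset
  have hG' := hG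
  obtain ⟨w, hw, hGw⟩ := hG'
  have hmemG : ∀ x ∈ σ, w x = 0 → x ∈ G := fun x hx h => by rw [hGw]; exact ⟨hx, h⟩
  have hwG : ∀ x ∈ G, w x = 0 := fun x hx => by rw [hGw] at hx; exact hx.2
  obtain ⟨l, hl, z, hzσ, hwz, hz⟩ := hσ.exists_pencil g w hw
    (fun z hz h => hg z (hmemG z hz h)) ⟨x, hxσ, fun h => hgx.ne (hg x (hmemG x hxσ h))⟩
  have hlpos : 0 < l := by
    by_contra hl0
    have h1 := hl x hxσ
    have h2 := mul_nonneg (neg_nonneg.2 (not_lt.1 hl0)) (hw x hxσ)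
    linarith
  have hF := IsFaceOf.of_pencil hl
  set F := {x | x ∈ σ ∧ g x + l * w x = 0}
  have hGF : G ⊆ F := fun t ht => ⟨hGσ ht, by simp [hg t ht, hwG t ht]⟩
  obtain ⟨τ, hτ, hGτ, hτd⟩ := (hG.of_subset hF.subset hGF).exists_covering (hF.isFGCone hσ)
    (fun h => hwz (hwG z (h ▸ ⟨hzσ, hz⟩)))
  obtain ⟨y, hyτ, hyG⟩ : ∃ y ∈ τ, y ∉ G := by
    by_contra! hcon
    rw [hGτ.antisymm hcon] at hτd
    omega
  have hyF := hτ.subset hyτ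
  have h1 := hcov τ (hF.trans hσ hτ) hGτ hτd y hyτ
  have h2 : 0 < w y :=
    lt_of_le_of_ne (hw y hyF.1) fun h => hyG (hmemG y hyF.1 h.symm)
  have h3 := hyF.2
  have := mul_pos hlpos h2
  linarith

theorem IsFGCone.zero_mem {n : ℕ} {σ : Set (Fin n → ℝ)} (hσ : IsFGCone σ) : 0 ∈ σ := by
  obtain ⟨T, rfl⟩ := hσ
  exact ⟨0, by simp, by simp⟩

/-- The vertex of a strongly convex finitely generated cone is a face. -/
theorem IsStronglyConvex.isFaceOf_zero {n : ℕ} {σ : Set (Fin n → ℝ)}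
    (hsc : IsStronglyConvex σ) (hσ : IsFGCone σ) : IsFaceOf σ {0} := by
  classical
  have h0σ := hσ.zero_mem
  obtain ⟨T, hT⟩ := hσ
  have hconv : (0 : Fin n → ℝ) ∉ convexHull ℝ ((T.erase 0 : Finset _) : Set (Fin n → ℝ)) := by
    intro h0
    rw [Finset.mem_convexHull'] at h0
    obtain ⟨c, hc0, hc1, hc⟩ := h0
    obtain ⟨s, hs, hcs⟩ : ∃ s ∈ T.erase 0, 0 < c s := by
      by_contra! hcon
      have := Finset.sum_nonpos hcon
      linarith
    have hsT := Finset.mem_of_mem_erase hs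
    have hsσ : s ∈ σ := by
      rw [hT]
      refine ⟨fun t => if t = s then 1 else 0, fun t => ?_, by simp [hsT]⟩
      dsimp only
      split_ifs <;> simp
    have hnsσ : -s ∈ σ := by
      rw [hT]
      refine ⟨fun t => if t ∈ (T.erase 0).erase s then c t / c s else 0, fun t => ?_, ?_⟩
      · dsimp only
        split_ifs with ht
        · exact div_nonneg (hc0 t (Finset.mem_of_mem_erase ht)) hcs.le
        · exact le_rfl
      · rw [← Finset.add_sum_erase _ _ hs] at hc
        have h1 : ∑ t ∈ T, (if t ∈ (T.erase 0).erase s then c t / c s else 0) • t =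
            (c s)⁻¹ • ∑ t ∈ (T.erase 0).erase s, c t • t := by
          rw [Finset.smul_sum, ← Finset.sum_subset (s₁ := (T.erase 0).erase s) (s₂ := T)]
          · refine Finset.sum_congr rfl fun t ht => ?_
            rw [if_pos ht, smul_smul, div_eq_inv_mul]
          · exact (Finset.erase_subset _ _).trans (Finset.erase_subset _ _)
          · intro t _ ht
            rw [if_neg ht, zero_smul]
        rw [h1, eq_neg_of_add_eq_zero_right hc, smul_neg, smul_smul,
          inv_mul_cancel₀ hcs.ne', one_smul]
    exact (Finset.mem_erase.1 hs).1 (hsc s hsσ hnsσ)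
  obtain ⟨f, a, hf0, hf⟩ := geometric_hahn_banach_point_closed (convex_convexHull ℝ _)
    ((T.erase 0).finite_toSet.isCompact_convexHull (𝕜 := ℝ)).isClosed hconv
  rw [map_zero] at hf0
  have hpos : ∀ s ∈ T.erase 0, 0 < f s := fun s hs =>
    hf0.trans (hf s (subset_convexHull ℝ _ hs))
  have hnonneg : ∀ s ∈ T, 0 ≤ f s := fun s hs => by
    by_cases h : s = 0
    · simp [h]
    · exact (hpos s (Finset.mem_erase.2 ⟨h, hs⟩)).le
  refine ⟨f.toLinearMap, ?_, Set.ext fun x => ⟨?_, ?_⟩⟩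
  · intro x hx
    rw [hT] at hx
    obtain ⟨c, hc, rfl⟩ := hx
    rw [map_sum]
    refine Finset.sum_nonneg fun s hs => ?_
    rw [map_smul]
    exact mul_nonneg (hc s) (hnonneg s hs)
  · rintro rfl
    exact ⟨h0σ, map_zero _⟩
  · rintro ⟨hx, hfx⟩
    rw [hT] at hx
    obtain ⟨c, hc, rfl⟩ := hx
    refine Finset.sum_eq_zero fun s hs => ?_
    rw [map_sum, Finset.sum_eq_zero_iff_of_nonneg] at hfx
    · by_cases h : s = 0
      · simp [h]
      · have := hfx s hs
        rw [map_smul, smul_eq_mul, mul_eq_zero] at this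
        rw [this.resolve_right (hpos s (Finset.mem_erase.2 ⟨h, hs⟩)).ne', zero_smul]
    · intro t ht
      rw [map_smul]
      exact mul_nonneg (hc t) (hnonneg t ht)

theorem faceDim_zero {n : ℕ} : faceDim ({0} : Set (Fin n → ℝ)) = 0 := by
  simp [faceDim]

/-- On a face covering `G`, a functional vanishing on `G` is a multiple of one exposing `G`. -/
theorem exists_eq_mul_of_covering {n : ℕ} {G τ : Set (Fin n → ℝ)} (hGτ : G ⊆ τ)
    (hdim : faceDim τ = faceDim G + 1) {g w : (Fin n → ℝ) →ₗ[ℝ] ℝ}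
    (hg : ∀ x ∈ G, g x = 0) (hw : ∀ x ∈ G, w x = 0) (hwτ : ∀ x ∈ τ, w x = 0 → x ∈ G) :
    ∃ c : ℝ, ∀ x ∈ τ, g x = c * w x := by
  obtain ⟨z, hzτ, hzG⟩ : ∃ z ∈ τ, z ∉ G := by
    by_contra! hcon
    rw [hGτ.antisymm hcon] at hdim
    omega
  have hwz : w z ≠ 0 := fun h => hzG (hwτ z hzτ h)
  have hlt : Submodule.span ℝ G < Submodule.span ℝ (insert z G) := by
    refine lt_of_le_of_ne (Submodule.span_mono (Set.subset_insert z G)) fun h => hwz ?_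
    exact eq_zero_of_mem_span hw (h ▸ Submodule.subset_span (Set.mem_insert z G))
  have heq : Submodule.span ℝ (insert z G) = Submodule.span ℝ τ := by
    refine Submodule.eq_of_le_of_finrank_le
      (Submodule.span_mono (Set.insert_subset hzτ hGτ)) ?_
    have := Submodule.finrank_lt_finrank_of_lt hlt
    unfold faceDim at hdim
    omega
  refine ⟨g z / w z, fun x hx => ?_⟩
  have h0 : (g - (g z / w z) • w) x = 0 := by
    refine eq_zero_of_mem_span (F := insert z G) ?_ (heq ▸ Submodule.subset_span hx)
    rintro y (rfl | hy)
    · simp [hwz]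
    · simp [hg y hy, hw y hy]
  simpa [sub_eq_zero] using h0

/-- If a functional vanishing on a face `G` takes both signs on the cone, then some face of
dimension `dim G + 2` is crossed by it: it contains a face covering `G` where the functional is
nonpositive, as well as a point where the functional is positive. -/
theorem IsFaceOf.exists_crossing {n : ℕ} {σ G : Set (Fin n → ℝ)} (hG : IsFaceOf σ G)
    (hσ : IsFGCone σ) (hfin : {τ | IsFaceOf σ τ ∧ faceDim τ = faceDim G + 1}.Finite)
    {g : (Fin n → ℝ) →ₗ[ℝ] ℝ} (hg : ∀ x ∈ G, g x = 0)
    (hneg : ∃ x ∈ σ, g x < 0) (hpos : ∃ x ∈ σ, 0 < g x) :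
    ∃ τ F, IsFaceOf σ τ ∧ IsFaceOf σ F ∧ G ⊆ τ ∧ τ ⊆ F ∧ faceDim τ = faceDim G + 1 ∧
      faceDim F = faceDim G + 2 ∧ (∀ x ∈ τ, g x ≤ 0) ∧ ∃ x ∈ F, 0 < g x := by
  have hG' := hG
  obtain ⟨w, hw, hGw⟩ := hG'
  have hmemG : ∀ x ∈ σ, w x = 0 → x ∈ G := fun x hx h => by rw [hGw]; exact ⟨hx, h⟩
  have hwG : ∀ x ∈ G, w x = 0 := fun x hx => by rw [hGw] at hx; exact hx.2
  have hslope : ∀ τ, IsFaceOf σ τ ∧ G ⊆ τ ∧ faceDim τ = faceDim G + 1 →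
      ∃ c : ℝ, ∀ x ∈ τ, g x = c * w x := fun τ h =>
    exists_eq_mul_of_covering h.2.1 h.2.2 hg hwG fun x hx => hmemG x (h.1.subset hx)
  choose! c hc using hslope
  have hnz : ∀ τ, IsFaceOf σ τ ∧ G ⊆ τ ∧ faceDim τ = faceDim G + 1 → ∃ x ∈ τ, 0 < w x := by
    rintro τ ⟨hτ, hGτ, hd⟩
    by_contra! hcon
    have : τ ⊆ G := fun x hx => hmemG x (hτ.subset hx)
      (le_antisymm (hcon x hx) (hw x (hτ.subset hx)))
    rw [hGτ.antisymm this] at hd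
    omega
  set S := {τ | (IsFaceOf σ τ ∧ G ⊆ τ ∧ faceDim τ = faceDim G + 1) ∧ c τ ≤ 0} with hS
  have hSfin : S.Finite := hfin.subset fun τ h => ⟨h.1.1, h.1.2.2⟩
  have hSne : S.Nonempty := by
    by_contra hemp
    obtain ⟨x, hx, hgx⟩ := hneg
    refine absurd (hG.nonneg_of_covering hσ g hg (fun τ h1 h2 h3 y hy => ?_) x hx) (not_le.2 hgx)
    rw [hc τ ⟨h1, h2, h3⟩ y hy]
    refine mul_nonneg ?_ (hw y (h1.subset hy))
    by_contra hneg'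
    exact hemp ⟨τ, ⟨h1, h2, h3⟩, (not_le.1 hneg').le⟩
  obtain ⟨τ, ⟨hτ, hcτ⟩, hmax⟩ := Set.exists_max_image S c hSfin hSne
  have hgτ : ∀ x ∈ τ, g x ≤ 0 := fun x hx => by
    rw [hc τ hτ x hx]
    exact mul_nonpos_of_nonpos_of_nonneg hcτ (hw x (hτ.1.subset hx))
  obtain ⟨F, hF, hτF, hFd, y, hyF, hy⟩ : ∃ F, IsFaceOf σ F ∧ τ ⊆ F ∧
      faceDim F = faceDim τ + 1 ∧ ∃ y ∈ F, 0 < g y - c τ * w y := by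
    by_contra! hcon
    obtain ⟨x, hx, hgx⟩ := hpos
    have := hτ.1.nonneg_of_covering hσ (c τ • w - g)
      (fun y hy => by simp [hc τ hτ y hy])
      (fun F h1 h2 h3 y hy => by
        have := hcon F h1 h2 h3 y hy
        simp only [LinearMap.sub_apply, LinearMap.smul_apply, smul_eq_mul]
        linarith) x hx
    simp only [LinearMap.sub_apply, LinearMap.smul_apply, smul_eq_mul] at this
    have := mul_nonpos_of_nonpos_of_nonneg hcτ (hw x hx)
    linarith
  refine ⟨τ, F, hτ.1, hF, hτ.2.1, hτF, hτ.2.2, by rw [hFd, hτ.2.2], hgτ, ?_⟩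
  by_contra! hcon
  have := (hG.of_subset hF.subset (hτ.2.1.trans hτF)).nonneg_of_covering (hF.isFGCone hσ)
    (c τ • w - g) (fun y hy => by simp [hg y hy, hwG y hy])
    (fun τ' h1 h2 h3 z hz => by
      have h1' := hF.trans hσ h1
      have hτ' : IsFaceOf σ τ' ∧ G ⊆ τ' ∧ faceDim τ' = faceDim G + 1 := ⟨h1', h2, h3⟩
      have hcτ' : c τ' ≤ 0 := by
        obtain ⟨x, hx, hwx⟩ := hnz τ' hτ'
        have := hcon x (h1.subset hx)
        rw [hc τ' hτ' x hx] at this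
        by_contra hlt
        exact absurd (mul_pos (not_le.1 hlt) hwx) (not_lt.2 this)
      have := hmax τ' ⟨hτ', hcτ'⟩
      simp only [LinearMap.sub_apply, LinearMap.smul_apply, smul_eq_mul, hc τ' hτ' z hz]
      have := mul_le_mul_of_nonneg_right this (hw z (h1'.subset hz))
      linarith) y hyF
  simp only [LinearMap.sub_apply, LinearMap.smul_apply, smul_eq_mul] at this
  linarith

/-- A face that is not of codimension one is the intersection of the faces covering it: there are
at least two of them. -/
theorem IsFaceOf.exists_two_coverings {n : ℕ} {σ G : Set (Fin n → ℝ)} (hG : IsFaceOf σ G)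
    (hσ : IsFGCone σ) (hdim : faceDim G + 1 < faceDim σ) :
    ∃ τ₁ τ₂, τ₁ ≠ τ₂ ∧ (IsFaceOf σ τ₁ ∧ G ⊆ τ₁ ∧ faceDim τ₁ = faceDim G + 1) ∧
      (IsFaceOf σ τ₂ ∧ G ⊆ τ₂ ∧ faceDim τ₂ = faceDim G + 1) := by
  obtain ⟨τ, hτ, hGτ, hd⟩ := hG.exists_covering hσ (fun h => by rw [h] at hdim; omega)
  by_contra! hcon
  have huniq : ∀ τ', IsFaceOf σ τ' → G ⊆ τ' → faceDim τ' = faceDim G + 1 → τ' = τ := by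
    intro τ' h1 h2 h3
    by_contra hne
    exact hcon τ τ' (Ne.symm hne) ⟨hτ, hGτ, hd⟩ h1 h2 h3
  obtain ⟨x, hxσ, hx⟩ : ∃ x ∈ σ, x ∉ Submodule.span ℝ τ := by
    by_contra! hcon
    have := Submodule.finrank_mono (Submodule.span_le.2 hcon)
    unfold faceDim at *
    omega
  obtain ⟨g, hgx, hg⟩ := Submodule.exists_le_ker_of_notMem hx
  have hgτ : ∀ y ∈ τ, g y = 0 := fun y hy => hg (Submodule.subset_span hy)
  have h1 := hG.nonneg_of_covering hσ g (fun y hy => hgτ y (hGτ hy))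
    (fun τ' h1 h2 h3 y hy => (hgτ y (huniq τ' h1 h2 h3 ▸ hy)).ge) x hxσ
  have h2 := hG.nonneg_of_covering hσ (-g) (fun y hy => by simp [hgτ y (hGτ hy)])
    (fun τ' h1 h2 h3 y hy => by simp [hgτ y (huniq τ' h1 h2 h3 ▸ hy)]) x hxσ
  rw [LinearMap.neg_apply] at h2
  exact hgx (by linarith)

/-- A face of codimension two of a full-dimensional cone lies in at most two facets. -/
theorem not_three_facets {n : ℕ} {σ τ : Set (Fin n → ℝ)} (hfull : faceDim σ = n)
    (hτ : faceDim τ + 2 = n) (F : Fin 3 → Set (Fin n → ℝ)) (hF : ∀ i, IsFaceOf σ (F i))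
    (hd : ∀ i, faceDim (F i) + 1 = n) (hsub : ∀ i, τ ⊆ F i) : ¬ Function.Injective F := by
  intro hinj
  have hF' := hF
  choose u hu hFu using hF'
  have huF : ∀ i, ∀ x ∈ F i, u i x = 0 := fun i x hx => by rw [hFu i] at hx; exact hx.2
  have hmem : ∀ i, ∀ x ∈ σ, u i x = 0 → x ∈ F i := fun i x hx h => by
    rw [hFu i]; exact ⟨hx, h⟩
  have hne : ∀ i, ∃ x ∈ σ, u i x ≠ 0 := fun i => by
    by_contra! hcon
    have := (hF i).subset.antisymm fun x hx => hmem i x hx (hcon x hx)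
    have h2 := hd i
    rw [this] at h2
    omega
  have huτ : ∀ i, u i ∈ (Submodule.span ℝ τ).dualAnnihilator := fun i => by
    rw [Submodule.mem_dualAnnihilator]
    exact fun x hx => eq_zero_of_mem_span (fun y hy => huF i y (hsub i hy)) hx
  have hfr : finrank ℝ (Submodule.span ℝ τ).dualAnnihilator = 2 := by
    have := Subspace.finrank_add_finrank_dualAnnihilator_eq (Submodule.span ℝ τ)
    unfold faceDim at hτ
    rw [finrank_fin_fun] at this
    omega
  have hdep : ¬ LinearIndependent ℝ u := by
    intro h
    have h1 := finrank_span_eq_card h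
    have h2 := Submodule.finrank_mono (Submodule.span_le.2 (Set.range_subset_iff.2 huτ))
    rw [hfr] at h2
    exact absurd (h1.symm.trans_le h2) (by simp)
  rw [Fintype.not_linearIndependent_iff] at hdep
  obtain ⟨a, ha, hane⟩ := hdep
  have hlin : ∀ x, a 0 * u 0 x + a 1 * u 1 x + a 2 * u 2 x = 0 := by
    intro x
    have := congrArg (fun f => f x) ha
    simpa [Fin.sum_univ_three] using this
  have key : ∀ (i j k : Fin 3) (α β γ : ℝ), i ≠ k → j ≠ k → 0 ≤ α → 0 ≤ β →
      ¬ (α = 0 ∧ β = 0 ∧ γ = 0) → (∀ x, α * u i x + β * u j x + γ * u k x = 0) → False := by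
    intro i j k α β γ hik hjk hα hβ hnz h
    have hk : ∀ x ∈ F k, α * u i x = 0 ∧ β * u j x = 0 := by
      intro x hx
      have h1 := h x
      rw [huF k x hx, mul_zero, add_zero] at h1
      have h2 := mul_nonneg hα (hu i x ((hF k).subset hx))
      have h3 := mul_nonneg hβ (hu j x ((hF k).subset hx))
      constructor <;> linarith
    by_cases hα0 : α = 0
    · by_cases hβ0 : β = 0
      · obtain ⟨x, -, hx⟩ := hne k
        have := h x
        rw [hα0, hβ0, zero_mul, zero_mul, zero_add, zero_add, mul_eq_zero] at this
        exact hnz ⟨hα0, hβ0, this.resolve_right hx⟩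
      · refine hjk.symm (hinj ((hF j).eq_of_subset (hF k) (fun x hx => ?_) ?_))
        · exact hmem j x ((hF k).subset hx) ((mul_eq_zero.1 (hk x hx).2).resolve_left hβ0)
        · have := hd j; have := hd k; omega
    · refine hik.symm (hinj ((hF i).eq_of_subset (hF k) (fun x hx => ?_) ?_))
      · exact hmem i x ((hF k).subset hx) ((mul_eq_zero.1 (hk x hx).1).resolve_left hα0)
      · have := hd i; have := hd k; omega
  have hnz : ¬ (a 0 = 0 ∧ a 1 = 0 ∧ a 2 = 0) := by
    rintro ⟨h0, h1, h2⟩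
    obtain ⟨i, hi⟩ := hane
    fin_cases i <;> simp_all
  have h012 : ∀ ε : ℝ, ε ≠ 0 → ∀ i j k, i ≠ k → j ≠ k → 0 ≤ ε * a i → 0 ≤ ε * a j →
      (∀ x, a i * u i x + a j * u j x + a k * u k x = 0) →
      (a i = 0 → a j = 0 → a k = 0 → a 0 = 0 ∧ a 1 = 0 ∧ a 2 = 0) → False := by
    intro ε hε i j k hik hjk hi hj h hz
    refine key i j k (ε * a i) (ε * a j) (ε * a k) hik hjk hi hj ?_ fun x => ?_
    · rintro ⟨h0, h1, h2⟩
      exact hnz (hz ((mul_eq_zero.1 h0).resolve_left hε) ((mul_eq_zero.1 h1).resolve_left hε)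
        ((mul_eq_zero.1 h2).resolve_left hε))
    · linear_combination ε * h x
  have h01 : ∀ ε : ℝ, ε ≠ 0 → 0 ≤ ε * a 0 → 0 ≤ ε * a 1 → False := fun ε hε h0 h1 =>
    h012 ε hε 0 1 2 (by decide) (by decide) h0 h1 hlin fun h h' h'' => ⟨h, h', h''⟩
  have h02 : ∀ ε : ℝ, ε ≠ 0 → 0 ≤ ε * a 0 → 0 ≤ ε * a 2 → False := fun ε hε h0 h2 =>
    h012 ε hε 0 2 1 (by decide) (by decide) h0 h2 (fun x => by linarith [hlin x])
      fun h h' h'' => ⟨h, h'', h'⟩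
  have h12 : ∀ ε : ℝ, ε ≠ 0 → 0 ≤ ε * a 1 → 0 ≤ ε * a 2 → False := fun ε hε h1 h2 =>
    h012 ε hε 1 2 0 (by decide) (by decide) h1 h2 (fun x => by linarith [hlin x])
      fun h h' h'' => ⟨h'', h, h'⟩
  have hn : (-1 : ℝ) ≠ 0 := by norm_num
  rcases le_total 0 (a 0) with h0 | h0 <;> rcases le_total 0 (a 1) with h1 | h1
  · exact h01 1 one_ne_zero (by linarith) (by linarith)
  · rcases le_total 0 (a 2) with h2 | h2
    · exact h02 1 one_ne_zero (by linarith) (by linarith)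
    · exact h12 (-1) hn (by linarith) (by linarith)
  · rcases le_total 0 (a 2) with h2 | h2
    · exact h12 1 one_ne_zero (by linarith) (by linarith)
    · exact h02 (-1) hn (by linarith) (by linarith)
  · exact h01 (-1) hn (by linarith) (by linarith)

/-- An Euler-type inequality for a bipartite count: `E` is split by the relation `A`, and `B` is
covered by it, up to two exceptional elements of `R`. -/
theorem card_add_card_le_of_sweep {R E F : Type*} [Fintype R] [Fintype E] [Fintype F]
    (A : R → E → Prop) (B : R → F → Prop) (I : E → F → Prop) (top bot : R → Prop)
    (hA : ∀ r r' e, A r e → A r' e → r = r') (hB : ∀ f, ∃ r, B r f)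
    (hI : ∀ e (φ : Fin 3 → F), (∀ i, I e (φ i)) → ¬ Function.Injective φ)
    (hAB : ∀ r f, B r f → ∃ e e', e ≠ e' ∧ (A r e ∧ I e f) ∧ (A r e' ∧ I e' f))
    (hcross : ∀ r, ¬ top r → ¬ bot r → ∃ e f, A r e ∧ I e f ∧ ¬ B r f)
    (htop : ∀ r r', top r → top r' → r = r') (hbot : ∀ r r', bot r → bot r' → r = r') :
    Fintype.card R + Fintype.card F ≤ Fintype.card E + 2 := by
  classical
  have h2 : ∀ e, (Finset.univ.filter (fun f => I e f)).card ≤ 2 := by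
    intro e
    by_contra hlt
    obtain ⟨s, hs, hs3⟩ := Finset.exists_subset_card_eq (Nat.succ_le_of_lt (not_le.1 hlt))
    let φ : Fin 3 → F := fun i => (s.equivFinOfCardEq hs3).symm i
    refine hI e φ (fun i => ?_) ?_
    · exact (Finset.mem_filter.1 (hs ((s.equivFinOfCardEq hs3).symm i).2)).2
    · exact Subtype.val_injective.comp (Equiv.injective _)
  have hlocal : ∀ r, (Finset.univ.filter (fun f => B r f)).card + 1 ≤
      (Finset.univ.filter (fun e => A r e)).card +
        ((if top r then 1 else 0) + (if bot r then 1 else 0)) := by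
    intro r
    set a : F → ℕ := fun f => (Finset.univ.filter (fun e => A r e ∧ I e f)).card with ha
    have h3 : ∑ f, a f ≤ 2 * (Finset.univ.filter (fun e => A r e)).card := by
      have : ∑ f, a f =
          ∑ e ∈ Finset.univ.filter (fun e => A r e), (Finset.univ.filter (fun f => I e f)).card := by
        have := Finset.sum_card_bipartiteAbove_eq_sum_card_bipartiteBelow (fun e f => I e f)
          (s := Finset.univ.filter (fun e => A r e)) (t := (Finset.univ : Finset F))
        simp only [Finset.bipartiteAbove, Finset.bipartiteBelow, Finset.filter_filter] at this
        exact this.symm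
      rw [this, mul_comm]
      exact Finset.sum_le_card_nsmul _ _ _ fun e _ => h2 e
    have hBa : ∀ f, B r f → 2 ≤ a f := by
      intro f hf
      obtain ⟨e, e', hne, he, he'⟩ := hAB r f hf
      exact Finset.one_lt_card.2 ⟨e, by simpa using he, e', by simpa using he', hne⟩
    have h4 : 2 * (Finset.univ.filter (fun f => B r f)).card ≤
        ∑ f ∈ Finset.univ.filter (fun f => B r f), a f := by
      rw [mul_comm]
      exact Finset.card_nsmul_le_sum _ _ _ fun f hf => hBa f (Finset.mem_filter.1 hf).2
    have h5 := Finset.sum_filter_add_sum_filter_not Finset.univ (fun f => B r f) a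
    by_cases ht : top r
    · rw [if_pos ht]
      omega
    by_cases hb : bot r
    · rw [if_pos hb]
      omega
    obtain ⟨e, f, he, hef, hf⟩ := hcross r ht hb
    have h6 : a f ≤ ∑ f ∈ Finset.univ.filter (fun f => ¬ B r f), a f :=
      Finset.single_le_sum (fun _ _ => Nat.zero_le _) (by simpa using hf)
    have h7 : 0 < a f := Finset.card_pos.2 ⟨e, by simp [he, hef]⟩
    omega
  have hsum := Finset.sum_le_sum fun r (_ : r ∈ Finset.univ) => hlocal r
  simp only [Finset.sum_add_distrib] at hsum
  have htop1 : ∑ r : R, (if top r then 1 else 0) ≤ 1 := by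
    rw [← Finset.card_filter]
    exact Finset.card_le_one.2 fun x hx y hy =>
      htop x y (Finset.mem_filter.1 hx).2 (Finset.mem_filter.1 hy).2
  have hbot1 : ∑ r : R, (if bot r then 1 else 0) ≤ 1 := by
    rw [← Finset.card_filter]
    exact Finset.card_le_one.2 fun x hx y hy =>
      hbot x y (Finset.mem_filter.1 hx).2 (Finset.mem_filter.1 hy).2
  have hF : Fintype.card F ≤ ∑ r, (Finset.univ.filter (fun f => B r f)).card := by
    have := Finset.sum_card_bipartiteAbove_eq_sum_card_bipartiteBelow B
      (s := (Finset.univ : Finset R)) (t := (Finset.univ : Finset F))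
    simp only [Finset.bipartiteAbove, Finset.bipartiteBelow] at this
    rw [this, ← Finset.card_univ, Finset.card_eq_sum_ones]
    refine Finset.sum_le_sum fun f _ => ?_
    obtain ⟨r, hr⟩ := hB f
    exact Finset.card_pos.2 ⟨r, by simpa using hr⟩
  have hE : ∑ r, (Finset.univ.filter (fun e => A r e)).card ≤ Fintype.card E := by
    have := Finset.sum_card_bipartiteAbove_eq_sum_card_bipartiteBelow A
      (s := (Finset.univ : Finset R)) (t := (Finset.univ : Finset E))
    simp only [Finset.bipartiteAbove, Finset.bipartiteBelow] at this
    rw [this, ← Finset.card_univ, Finset.card_eq_sum_ones]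
    refine Finset.sum_le_sum fun e _ => ?_
    exact Finset.card_le_one.2 fun x hx y hy =>
      hA x y e (Finset.mem_filter.1 hx).2 (Finset.mem_filter.1 hy).2
  have hR : ∑ _r : R, 1 = Fintype.card R := by simp
  omega

/-- The span of a one-dimensional set is spanned by any nonzero element of it. -/
theorem exists_eq_smul_of_faceDim_eq_one {n : ℕ} {ρ : Set (Fin n → ℝ)} (h : faceDim ρ = 1)
    {r : Fin n → ℝ} (hr : r ∈ Submodule.span ℝ ρ) (hr0 : r ≠ 0) {x : Fin n → ℝ} (hx : x ∈ ρ) :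
    ∃ c : ℝ, c • r = x := by
  obtain ⟨c, hc⟩ := (finrank_eq_one_iff_of_nonzero' (⟨r, hr⟩ : Submodule.span ℝ ρ)
    (fun h => hr0 (congrArg Subtype.val h))).1 h ⟨x, Submodule.subset_span hx⟩
  exact ⟨c, congrArg Subtype.val hc⟩

theorem IsFGCone.smul_mem {n : ℕ} {σ : Set (Fin n → ℝ)} (hσ : IsFGCone σ) {x : Fin n → ℝ}
    (hx : x ∈ σ) {a : ℝ} (ha : 0 ≤ a) : a • x ∈ σ := by
  obtain ⟨T, rfl⟩ := hσ
  obtain ⟨c, hc, rfl⟩ := hx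
  exact ⟨fun s => a * c s, fun s => mul_nonneg ha (hc s), by simp [Finset.smul_sum, smul_smul]⟩

/-- A functional separating finitely many points. -/
theorem exists_injective_functional {n : ℕ} {R : Type*} [Finite R] (r : R → Fin n → ℝ)
    (hr : Function.Injective r) :
    ∃ u : (Fin n → ℝ) →ₗ[ℝ] ℝ, ∀ i j, u (r i) = u (r j) → i = j := by
  have h : ∀ p : {p : R × R // p.1 ≠ p.2}, ∃ u ∈ (⊤ : Submodule ℝ (Dual ℝ (Fin n → ℝ))),
      Dual.eval ℝ (Fin n → ℝ) (r p.1.1 - r p.1.2) u ≠ 0 := by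
    rintro ⟨⟨i, j⟩, hij⟩
    obtain ⟨u, hu, -⟩ := Submodule.exists_le_ker_of_notMem
      (p := (⊥ : Submodule ℝ (Fin n → ℝ))) (v := r i - r j)
      (fun h => hij (hr (sub_eq_zero.1 h)))
    exact ⟨u, trivial, hu⟩
  obtain ⟨u, -, hu⟩ := Module.Dual.exists_forall_mem_ne_zero_of_forall_exists _ _ h
  refine ⟨u, fun i j hij => ?_⟩
  by_contra hne
  refine hu ⟨(i, j), hne⟩ ?_
  simp [hij]

/-- Half of Euler's relation for the face numbers of a four-dimensional cone. -/
theorem card_rays_add_card_facets_le {σ : Set (Fin 4 → ℝ)} (hσ : IsFGCone σ)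
    (hsc : IsStronglyConvex σ) (hfull : faceDim σ = 4)
    [Fintype {F : Set (Fin 4 → ℝ) // IsFaceOf σ F ∧ faceDim F = 1}]
    [Fintype {F : Set (Fin 4 → ℝ) // IsFaceOf σ F ∧ faceDim F = 2}]
    [Fintype {F : Set (Fin 4 → ℝ) // IsFaceOf σ F ∧ faceDim F = 3}] :
    Fintype.card {F : Set (Fin 4 → ℝ) // IsFaceOf σ F ∧ faceDim F = 1} +
      Fintype.card {F : Set (Fin 4 → ℝ) // IsFaceOf σ F ∧ faceDim F = 3} ≤
      Fintype.card {F : Set (Fin 4 → ℝ) // IsFaceOf σ F ∧ faceDim F = 2} + 2 := by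
  have hzero := hsc.isFaceOf_zero hσ
  have hzero' := hzero
  obtain ⟨l, hl, hl0⟩ := hzero'
  have hlpos : ∀ x ∈ σ, x ≠ 0 → 0 < l x := fun x hx hx0 =>
    lt_of_le_of_ne (hl x hx) fun h => hx0 (by
      have : x ∈ ({0} : Set (Fin 4 → ℝ)) := hl0 ▸ ⟨hx, h.symm⟩
      exact this)
  have hgen : ∀ ρ : {F : Set (Fin 4 → ℝ) // IsFaceOf σ F ∧ faceDim F = 1},
      ∃ r ∈ ρ.1, l r = 1 := by
    rintro ⟨ρ, hρ, hd⟩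
    obtain ⟨x, hx, hx0⟩ : ∃ x ∈ ρ, x ≠ 0 := by
      by_contra! hcon
      have h1 : faceDim ρ ≤ faceDim ({0} : Set (Fin 4 → ℝ)) :=
        Submodule.finrank_mono (Submodule.span_mono hcon)
      rw [faceDim_zero] at h1
      omega
    have := hlpos x (hρ.subset hx) hx0
    exact ⟨(l x)⁻¹ • x, (hρ.isFGCone hσ).smul_mem hx (inv_nonneg.2 this.le), by
      rw [map_smul, smul_eq_mul, inv_mul_cancel₀ this.ne']⟩
  choose r hr hlr using hgen
  have hr0 : ∀ ρ, r ρ ≠ 0 := fun ρ h => by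
    have := hlr ρ
    rw [h, map_zero] at this
    exact zero_ne_one this
  have hspan : ∀ ρ, ∀ x ∈ ρ.1, l x • r ρ = x := fun ρ x hx => by
    obtain ⟨c, rfl⟩ := exists_eq_smul_of_faceDim_eq_one ρ.2.2
      (Submodule.subset_span (hr ρ)) (hr0 ρ) hx
    rw [map_smul, hlr, smul_eq_mul, mul_one]
  have hrinj : Function.Injective r := by
    intro ρ ρ' h
    refine Subtype.ext (Set.Subset.antisymm (fun x hx => ?_) fun x hx => ?_)
    · rw [← hspan ρ x hx, h]
      exact (ρ'.2.1.isFGCone hσ).smul_mem (hr ρ') (hl x (ρ.2.1.subset hx))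
    · rw [← hspan ρ' x hx, ← h]
      exact (ρ.2.1.isFGCone hσ).smul_mem (hr ρ) (hl x (ρ'.2.1.subset hx))
  obtain ⟨u, hu⟩ := exists_injective_functional r hrinj
  set g : {F : Set (Fin 4 → ℝ) // IsFaceOf σ F ∧ faceDim F = 1} → (Fin 4 → ℝ) →ₗ[ℝ] ℝ :=
    fun ρ => u - u (r ρ) • l with hgdef
  have hg : ∀ ρ x, g ρ x = u x - u (r ρ) * l x := fun ρ x => by simp [hgdef]
  have hgρ : ∀ ρ, ∀ x ∈ ρ.1, g ρ x = 0 := fun ρ x hx => by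
    rw [hg]
    nth_rw 1 [← hspan ρ x hx]
    rw [map_smul, smul_eq_mul]
    ring
  have hfin : ∀ ρ : {F : Set (Fin 4 → ℝ) // IsFaceOf σ F ∧ faceDim F = 1},
      {τ | IsFaceOf σ τ ∧ faceDim τ = faceDim ρ.1 + 1}.Finite := by
    intro ρ
    rw [ρ.2.2]
    exact Set.finite_coe_iff.1 (inferInstanceAs
      (Finite {F : Set (Fin 4 → ℝ) // IsFaceOf σ F ∧ faceDim F = 2}))
  have huniq : ∀ ρ ρ' : {F : Set (Fin 4 → ℝ) // IsFaceOf σ F ∧ faceDim F = 1},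
      ∀ τ, ρ.1 ⊆ τ → ρ'.1 ⊆ τ → (∀ x ∈ τ, g ρ x ≤ 0) → (∀ x ∈ τ, g ρ' x ≤ 0) → ρ = ρ' := by
    intro ρ ρ' τ h h' hτ hτ'
    have h1 := hτ _ (h' (hr ρ'))
    have h2 := hτ' _ (h (hr ρ))
    rw [hg, hlr] at h1 h2
    exact hu _ _ (by linarith)
  refine card_add_card_le_of_sweep
    (fun ρ τ => ρ.1 ⊆ τ.1 ∧ ∀ x ∈ τ.1, g ρ x ≤ 0) (fun ρ F => ρ.1 ⊆ F.1 ∧ ∀ x ∈ F.1, g ρ x ≤ 0)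
    (fun τ F => τ.1 ⊆ F.1) (fun ρ => ∀ x ∈ σ, g ρ x ≤ 0) (fun ρ => ∀ x ∈ σ, 0 ≤ g ρ x)
    ?_ ?_ ?_ ?_ ?_ ?_ ?_
  · exact fun ρ ρ' τ h h' => huniq ρ ρ' τ.1 h.1 h'.1 h.2 h'.2
  · rintro ⟨F, hF, hFd⟩
    have hz := hzero.of_subset hF.subset
      (Set.singleton_subset_iff.2 (hF.isFGCone hσ).zero_mem)
    have hne : {ρ : {F : Set (Fin 4 → ℝ) // IsFaceOf σ F ∧ faceDim F = 1} | ρ.1 ⊆ F}.Nonempty := by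
      obtain ⟨ρ, hρ, -, hd⟩ := hz.exists_covering (hF.isFGCone hσ) (fun h => by
        rw [← h, faceDim_zero] at hFd
        omega)
      exact ⟨⟨ρ, hF.trans hσ hρ, by rw [hd, faceDim_zero]⟩, hρ.subset⟩
    obtain ⟨ρ, hρF, hmax⟩ := Set.exists_max_image _ (fun ρ => u (r ρ)) (Set.toFinite _) hne
    refine ⟨ρ, hρF, fun x hx => ?_⟩
    have := hz.nonneg_of_covering (hF.isFGCone hσ) (-g ρ) (by simp) (fun ρ' h1 _ h3 y hy => by
      rw [faceDim_zero, zero_add] at h3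
      have h4 := hmax ⟨ρ', hF.trans hσ h1, h3⟩ h1.subset
      have h5 := mul_le_mul_of_nonneg_left h4 (hl y (hF.subset (h1.subset hy)))
      have h6 := congrArg u (hspan ⟨ρ', hF.trans hσ h1, h3⟩ y hy)
      rw [map_smul, smul_eq_mul] at h6
      rw [LinearMap.neg_apply, hg]
      linarith) x hx
    simpa using this
  · intro τ φ hφ hinj
    exact not_three_facets hfull (by rw [τ.2.2]) (fun i => (φ i).1) (fun i => (φ i).2.1)
      (fun i => by rw [(φ i).2.2]) hφ (Subtype.val_injective.comp hinj)
  · rintro ρ ⟨F, hF, hFd⟩ ⟨hρF, hgF⟩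
    obtain ⟨τ₁, τ₂, hne, h1, h2⟩ := (ρ.2.1.of_subset hF.subset hρF).exists_two_coverings
      (hF.isFGCone hσ) (by rw [ρ.2.2, hFd]; norm_num)
    rw [ρ.2.2] at h1 h2
    exact ⟨⟨τ₁, hF.trans hσ h1.1, h1.2.2⟩, ⟨τ₂, hF.trans hσ h2.1, h2.2.2⟩,
      fun h => hne (congrArg Subtype.val h),
      ⟨⟨h1.2.1, fun x hx => hgF x (h1.1.subset hx)⟩, h1.1.subset⟩,
      ⟨⟨h2.2.1, fun x hx => hgF x (h2.1.subset hx)⟩, h2.1.subset⟩⟩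
  · intro ρ htop hbot
    push Not at htop hbot
    obtain ⟨τ, F, hτ, hF, hρτ, hτF, hτd, hFd, hgτ, x, hxF, hx⟩ :=
      ρ.2.1.exists_crossing hσ (hfin ρ) (hgρ ρ) hbot htop
    rw [ρ.2.2] at hτd hFd
    exact ⟨⟨τ, hτ, hτd⟩, ⟨F, hF, hFd⟩, ⟨hρτ, hgτ⟩, hτF, fun h => (h.2 x hxF).not_gt hx⟩
  · exact fun ρ ρ' h h' => huniq ρ ρ' σ ρ.2.1.subset ρ'.2.1.subset h h'
  · intro ρ ρ' h h'
    have h1 := h _ (ρ'.2.1.subset (hr ρ'))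
    have h2 := h' _ (ρ.2.1.subset (hr ρ))
    rw [hg, hlr] at h1 h2
    exact hu _ _ (by linarith)

/-- The rays of a strongly convex full-dimensional cone span the ambient space. -/
theorem span_rays_eq_top {n : ℕ} {σ : Set (Fin n → ℝ)} (hσ : IsFGCone σ)
    (hsc : IsStronglyConvex σ) (hfull : faceDim σ = n) (W : Submodule ℝ (Fin n → ℝ))
    (hW : ∀ ρ, IsFaceOf σ ρ → faceDim ρ = 1 → ρ ⊆ W) : W = ⊤ := by
  by_contra hne
  obtain ⟨g, hg, hgW⟩ := Submodule.exists_le_ker_of_lt_top W (lt_top_iff_ne_top.2 hne)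
  have hzero := hsc.isFaceOf_zero hσ
  have hρ : ∀ ρ, IsFaceOf σ ρ → {0} ⊆ ρ → faceDim ρ = faceDim ({0} : Set (Fin n → ℝ)) + 1 →
      ∀ x ∈ ρ, g x = 0 := fun ρ h1 _ h3 x hx =>
    hgW (hW ρ h1 (by rw [h3, faceDim_zero]) hx)
  have h1 := hzero.nonneg_of_covering hσ g (by simp)
    fun ρ h1 h2 h3 x hx => (hρ ρ h1 h2 h3 x hx).ge
  have h2 := hzero.nonneg_of_covering hσ (-g) (by simp)
    fun ρ h1 h2 h3 x hx => by simp [hρ ρ h1 h2 h3 x hx]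
  have hspan : Submodule.span ℝ σ = ⊤ :=
    Submodule.eq_top_of_finrank_eq (by rw [finrank_fin_fun]; exact hfull)
  refine hg (LinearMap.ext fun x => ?_)
  refine eq_zero_of_mem_span (F := σ) (fun y hy => ?_) (hspan ▸ Submodule.mem_top)
  have := h2 y hy
  rw [LinearMap.neg_apply] at this
  linarith [h1 y hy]

theorem finrank_alternatingMap {V : Type*} [AddCommGroup V] [Module ℝ V]
    [FiniteDimensional ℝ V] (k : ℕ) :
    finrank ℝ (V [⋀^Fin k]→ₗ[ℝ] ℝ) = (finrank ℝ V).choose k := by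
  rw [(exteriorPower.alternatingMapLinearEquiv (R := ℝ) (n := k) (M := V) (N := ℝ)).finrank_eq]
  exact (Subspace.dual_finrank_eq (K := ℝ)).trans
    (exteriorPower.finrank_eq (R := ℝ) (M := V) (n := k))

instance finiteDimensional_alternatingMap {V : Type*} [AddCommGroup V] [Module ℝ V]
    [FiniteDimensional ℝ V] (k : ℕ) : FiniteDimensional ℝ (V [⋀^Fin k]→ₗ[ℝ] ℝ) :=
  Module.Finite.equiv
    (exteriorPower.alternatingMapLinearEquiv (R := ℝ) (n := k) (M := V) (N := ℝ)).symm

theorem finrank_Ann_le {n : ℕ} (μ : Set (Fin n → ℝ)) (k : ℕ) :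
    finrank ℝ (Ann μ k) ≤ (n - faceDim μ).choose k := by
  obtain ⟨C, hC⟩ := (Submodule.span ℝ μ).exists_isCompl
  have hdim : finrank ℝ C = n - faceDim μ := by
    have := Submodule.finrank_add_eq_of_isCompl hC
    rw [finrank_fin_fun] at this
    unfold faceDim
    omega
  rw [← hdim, ← finrank_alternatingMap]
  let φ : Ann μ k →ₗ[ℝ] (C [⋀^Fin k]→ₗ[ℝ] ℝ) :=
    { toFun := fun ω => ω.1.compLinearMap C.subtype
      map_add' := fun _ _ => rfl
      map_smul' := fun _ _ => rfl }
  refine LinearMap.finrank_le_finrank_of_injective (f := φ) ?_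
  refine (LinearMap.ker_eq_bot (R := ℝ) (M := Ann μ k)).1
    ((LinearMap.ker_eq_bot' (R := ℝ) (M := Ann μ k)).2 ?_)
  rintro ⟨ω, hω⟩ h
  refine Subtype.ext ?_
  let b := ((Module.finBasis ℝ (Submodule.span ℝ μ)).prod (Module.finBasis ℝ C)).map
    (Submodule.prodEquivOfIsCompl _ _ hC)
  refine Basis.ext_alternating b fun v _ => ?_
  by_cases hv : ∃ i j, v i = Sum.inl j
  · obtain ⟨i, j, hij⟩ := hv
    refine hω _ ⟨i, ?_⟩
    simp [b, hij]
  · have hv' : ∀ i, ∃ c : C, (c : Fin n → ℝ) = b (v i) := fun i => by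
      rcases hvi : v i with j | j
      · exact absurd ⟨i, j, hvi⟩ hv
      · exact ⟨Module.finBasis ℝ C j, by simp [b]⟩
    choose c hc using hv'
    have := DFunLike.congr_fun h c
    simp only [← hc]
    exact this

theorem le_finrank_Ann_one {n : ℕ} (τ : Set (Fin n → ℝ)) :
    n - faceDim τ ≤ finrank ℝ (Ann τ (0 + 1)) := by
  have hfr := Subspace.finrank_add_finrank_dualAnnihilator_eq (Submodule.span ℝ τ)
  rw [finrank_fin_fun] at hfr
  let φ : (Submodule.span ℝ τ).dualAnnihilator →ₗ[ℝ] Ann τ (0 + 1) :=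
    haveI : Subsingleton (Fin (0 + 1)) := inferInstanceAs (Subsingleton (Fin 1))
    { toFun := fun f => ⟨AlternatingMap.ofSubsingleton ℝ (Fin n → ℝ) ℝ (0 : Fin (0 + 1)) f.1, by
        rintro v ⟨i, hi⟩
        rw [Subsingleton.elim i 0] at hi
        exact (Submodule.mem_dualAnnihilator _).1 f.2 _ hi⟩
      map_add' := fun _ _ => rfl
      map_smul' := fun _ _ => rfl }
  have := LinearMap.finrank_le_finrank_of_injective (f := φ) (fun f f' h => by
    have : Subsingleton (Fin (0 + 1)) := inferInstanceAs (Subsingleton (Fin 1))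
    refine Subtype.ext ?_
    exact (AlternatingMap.ofSubsingleton ℝ (Fin n → ℝ) ℝ (0 : Fin (0 + 1))).injective
      (congrArg Subtype.val h))
  unfold faceDim
  omega

theorem finrank_pi_Ann {n : ℕ} {ι : Type*} [Fintype ι] (μ : ι → Set (Fin n → ℝ)) (k : ℕ) :
    finrank ℝ (∀ i, Ann (μ i) k) = ∑ i, finrank ℝ (Ann (μ i) k) := by
  have : ∀ i, Module.Free ℝ (Ann (μ i) k) :=
    fun i => Module.Free.of_divisionRing ℝ (Ann (μ i) k)
  have : ∀ i, Module.Finite ℝ (Ann (μ i) k) :=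
    fun i => FiniteDimensional.finiteDimensional_submodule (Ann (μ i) k)
  exact Module.finrank_pi_fintype ℝ (M := fun i => Ann (μ i) k)

/-- A complex `A → B → C → D` that is injective at `A` and has positive Euler characteristic is not
exact at `C`. -/
theorem not_ker_le_range_of_finrank_lt {A B C D : Type*} [AddCommGroup A] [Module ℝ A]
    [AddCommGroup B] [Module ℝ B] [AddCommGroup C] [Module ℝ C] [AddCommGroup D] [Module ℝ D]
    [FiniteDimensional ℝ B] [FiniteDimensional ℝ C] [FiniteDimensional ℝ D]
    (d0 : A →ₗ[ℝ] B) (d1 : B →ₗ[ℝ] C) (d2 : C →ₗ[ℝ] D) (hd0 : ∀ a, d0 a = 0 → a = 0)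
    (hc : d1 ∘ₗ d0 = 0) (hlt : finrank ℝ B + finrank ℝ D < finrank ℝ A + finrank ℝ C) :
    ¬ LinearMap.ker d2 ≤ LinearMap.range d1 := by
  intro hle
  have h0 := LinearMap.finrank_range_of_inj ((injective_iff_map_eq_zero d0).2 hd0)
  have h1 := LinearMap.finrank_range_add_finrank_ker d1
  have h2 := LinearMap.finrank_range_add_finrank_ker d2
  have h3 := Submodule.finrank_mono (LinearMap.range_le_ker_iff.2 hc)
  have h4 := Submodule.finrank_le (LinearMap.range d2)
  have h5 := Submodule.finrank_mono hle
  omega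

open scoped Classical in
/-- Let `σ` be a full-dimensional strongly convex rational polyhedral cone
of dimension 4 in `ℝ⁴` whose number of 3-dimensional faces is strictly larger than its
number of 1-dimensional faces.  Then `H²(Ish³_σ) ≠ 0`, where `Ish³_σ` is the degree-zero
part of the third Ishida complex
`Λ³M_ℝ → ⊕_{μ∈P₁} Λ²μ^⊥ → ⊕_{μ∈P₂} Λ¹μ^⊥ → ⊕_{μ∈P₃} ℝ`,
with differentials given componentwise (for faces `μ ⊂ τ` with `dim τ = dim μ + 1`) by
contraction against vectors `n_{μ,τ} ∈ ⟨τ⟩ \ ⟨μ⟩` pointing into `τ` (nonnegative against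
every functional that is nonnegative on `τ` and vanishes on `μ`). -/
theorem stmt_5 (σ : Set (Fin 4 → ℝ))
    (hpoly : IsRatPolyhedralCone σ) (hsc : IsStronglyConvex σ) (hfull : faceDim σ = 4)
    [Fintype {F : Set (Fin 4 → ℝ) // IsFaceOf σ F ∧ faceDim F = 1}]
    [Fintype {F : Set (Fin 4 → ℝ) // IsFaceOf σ F ∧ faceDim F = 2}]
    [Fintype {F : Set (Fin 4 → ℝ) // IsFaceOf σ F ∧ faceDim F = 3}]
    -- the cone has strictly more facets than rays:
    (hcount : Fintype.card {F : Set (Fin 4 → ℝ) // IsFaceOf σ F ∧ faceDim F = 1} <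
      Fintype.card {F : Set (Fin 4 → ℝ) // IsFaceOf σ F ∧ faceDim F = 3})
    -- the contraction vectors `n_{μ,τ}`:
    (𝓃 : Set (Fin 4 → ℝ) → Set (Fin 4 → ℝ) → (Fin 4 → ℝ))
    (h𝓃 : ∀ μ τ : Set (Fin 4 → ℝ), IsFaceOf σ μ → IsFaceOf σ τ → μ ⊆ τ →
      faceDim τ = faceDim μ + 1 →
      𝓃 μ τ ∈ Submodule.span ℝ τ ∧ 𝓃 μ τ ∉ Submodule.span ℝ μ ∧
        (∀ u : (Fin 4 → ℝ) →ₗ[ℝ] ℝ, (∀ x ∈ τ, 0 ≤ u x) → (∀ x ∈ μ, u x = 0) →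
          0 ≤ u (𝓃 μ τ)))
    -- the differentials of the complex `Ish³_σ`:
    (d0 : ((Fin 4 → ℝ) [⋀^Fin (2+1)]→ₗ[ℝ] ℝ) →ₗ[ℝ]
      ((μ : {F : Set (Fin 4 → ℝ) // IsFaceOf σ F ∧ faceDim F = 1}) → ↥(Ann μ.1 (1+1))))
    (d1 : (((μ : {F : Set (Fin 4 → ℝ) // IsFaceOf σ F ∧ faceDim F = 1}) →
        ↥(Ann μ.1 (1+1)))) →ₗ[ℝ]
      ((τ : {F : Set (Fin 4 → ℝ) // IsFaceOf σ F ∧ faceDim F = 2}) → ↥(Ann τ.1 (0+1))))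
    (d2 : (((τ : {F : Set (Fin 4 → ℝ) // IsFaceOf σ F ∧ faceDim F = 2}) →
        ↥(Ann τ.1 (0+1)))) →ₗ[ℝ]
      ((τ : {F : Set (Fin 4 → ℝ) // IsFaceOf σ F ∧ faceDim F = 3}) → ↥(Ann τ.1 0)))
    (hd0 : ∀ ω (μ : {F : Set (Fin 4 → ℝ) // IsFaceOf σ F ∧ faceDim F = 1}),
      ((d0 ω μ : ↥(Ann μ.1 (1+1))) : (Fin 4 → ℝ) [⋀^Fin (1+1)]→ₗ[ℝ] ℝ) =
        ω.curryLeft (𝓃 {0} μ.1))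
    (hd1 : ∀ x (τ : {F : Set (Fin 4 → ℝ) // IsFaceOf σ F ∧ faceDim F = 2}),
      ((d1 x τ : ↥(Ann τ.1 (0+1))) : (Fin 4 → ℝ) [⋀^Fin (0+1)]→ₗ[ℝ] ℝ) =
        ∑ μ : {F : Set (Fin 4 → ℝ) // IsFaceOf σ F ∧ faceDim F = 1},
          if μ.1 ⊆ τ.1 then ((x μ : ↥(Ann μ.1 (1+1))) :
            (Fin 4 → ℝ) [⋀^Fin (1+1)]→ₗ[ℝ] ℝ).curryLeft (𝓃 μ.1 τ.1) else 0)
    (hd2 : ∀ x (τ : {F : Set (Fin 4 → ℝ) // IsFaceOf σ F ∧ faceDim F = 3}),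
      ((d2 x τ : ↥(Ann τ.1 0)) : (Fin 4 → ℝ) [⋀^Fin 0]→ₗ[ℝ] ℝ) =
        ∑ μ : {F : Set (Fin 4 → ℝ) // IsFaceOf σ F ∧ faceDim F = 2},
          if μ.1 ⊆ τ.1 then ((x μ : ↥(Ann μ.1 (0+1))) :
            (Fin 4 → ℝ) [⋀^Fin (0+1)]→ₗ[ℝ] ℝ).curryLeft (𝓃 μ.1 τ.1) else 0)
    (hc1 : d1 ∘ₗ d0 = 0) (hc2 : d2 ∘ₗ d1 = 0) :
    -- `H²(Ish³_σ) ≠ 0`: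
    ¬ (LinearMap.ker d2 ≤ LinearMap.range d1) := by
  have hσ := hpoly.isFGCone
  have hzero := hsc.isFaceOf_zero hσ
  have heuler := card_rays_add_card_facets_le hσ hsc hfull
  have hd0inj : ∀ ω, d0 ω = 0 → ω = 0 := by
    intro ω hω
    have htop := span_rays_eq_top hσ hsc hfull (LinearMap.ker ω.curryLeft) (by
      intro ρ hρ hd x hx
      obtain ⟨h1, h2, -⟩ := h𝓃 {0} ρ hzero hρ
        (Set.singleton_subset_iff.2 (hρ.isFGCone hσ).zero_mem) (by rw [faceDim_zero, hd])
      obtain ⟨c, rfl⟩ := exists_eq_smul_of_faceDim_eq_one hd h1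
        (fun h => h2 (by rw [h]; exact Submodule.zero_mem _)) hx
      have h3 := hd0 ω ⟨ρ, hρ, hd⟩
      rw [hω] at h3
      refine Submodule.smul_mem _ c ?_
      exact h3.symm)
    ext v
    have h4 : ω.curryLeft (v 0) = 0 :=
      LinearMap.mem_ker.1 (htop ▸ Submodule.mem_top)
    have h5 := DFunLike.congr_fun h4 (Matrix.vecTail v)
    rw [AlternatingMap.curryLeft_apply_apply] at h5
    rw [show v = Matrix.vecCons (v 0) (Matrix.vecTail v) from
      (Matrix.cons_head_tail v).symm]
    exact h5
  have hC1 := Finset.sum_le_card_nsmul Finset.univ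
    (fun μ : {F : Set (Fin 4 → ℝ) // IsFaceOf σ F ∧ faceDim F = 1} =>
      finrank ℝ (Ann μ.1 (1 + 1))) 3 (fun μ _ => by
        have := finrank_Ann_le μ.1 (1 + 1)
        rw [μ.2.2] at this
        exact this)
  have hC2 := Finset.card_nsmul_le_sum Finset.univ
    (fun τ : {F : Set (Fin 4 → ℝ) // IsFaceOf σ F ∧ faceDim F = 2} =>
      finrank ℝ (Ann τ.1 (0 + 1))) 2 (fun τ _ => by
        have := le_finrank_Ann_one τ.1
        rw [τ.2.2] at this
        exact this)
  have hC3 := Finset.sum_le_card_nsmul Finset.univ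
    (fun F : {F : Set (Fin 4 → ℝ) // IsFaceOf σ F ∧ faceDim F = 3} =>
      finrank ℝ (Ann F.1 0)) 1 (fun F _ => by
        have := finrank_Ann_le F.1 0
        rwa [Nat.choose_zero_right] at this)
  simp only [Finset.card_univ, smul_eq_mul] at hC1 hC2 hC3
  refine not_ker_le_range_of_finrank_lt
    (A := (Fin 4 → ℝ) [⋀^Fin (2 + 1)]→ₗ[ℝ] ℝ)
    (B := (μ : {F : Set (Fin 4 → ℝ) // IsFaceOf σ F ∧ faceDim F = 1}) → Ann μ.1 (1 + 1))
    (C := (τ : {F : Set (Fin 4 → ℝ) // IsFaceOf σ F ∧ faceDim F = 2}) → Ann τ.1 (0 + 1))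
    (D := (τ : {F : Set (Fin 4 → ℝ) // IsFaceOf σ F ∧ faceDim F = 3}) → Ann τ.1 0)
    d0 d1 d2 hd0inj hc1 ?_
  have hA : finrank ℝ ((Fin 4 → ℝ) [⋀^Fin (2 + 1)]→ₗ[ℝ] ℝ) = 4 := by
    rw [finrank_alternatingMap, finrank_fin_fun]
    rfl
  have hB := finrank_pi_Ann
    (fun μ : {F : Set (Fin 4 → ℝ) // IsFaceOf σ F ∧ faceDim F = 1} => μ.1) (1 + 1)
  have hC := finrank_pi_Ann
    (fun τ : {F : Set (Fin 4 → ℝ) // IsFaceOf σ F ∧ faceDim F = 2} => τ.1) (0 + 1)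
  have hD := finrank_pi_Ann
    (fun F : {F : Set (Fin 4 → ℝ) // IsFaceOf σ F ∧ faceDim F = 3} => F.1) 0
  rw [hA, hB, hC, hD]
  omega
end

section
/- Every polytope (equivalently, every strongly convex full-dimensional polyhedral cone) is shellable: for a full-dimensional cone σ of dimension n, there exists a linear ordering μ₁,...,μ_s of its facets such that the facets of μ₁ admit a shelling, and for each j > 1 the intersection μ_j ∩ (μ₁ ∪ ... ∪ μ_{j−1}) is a union λ₁ ∪ ... ∪ λ_r that is an initial segment of some shelling λ₁,...,λ_t of the facets of μ_j. -/
open Module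

/-- `IsShelling d σ L`: the list `L` is a shelling of the `d`-dimensional cone `σ`, i.e. an
enumeration without repetition of the facets ((d-1)-dimensional faces) of `σ` such that the
facets of the first entry admit a shelling, and for each `j > 1` the intersection of the
`j`-th facet with the union of the previous ones is the union of an initial segment
`λ₁ ∪ … ∪ λ_r` of some shelling `λ₁, …, λ_t` of the facets of the `j`-th facet.  Cones of
dimension `1` are shellable by convention. -/
def IsShelling {n : ℕ} : ℕ → Set (Fin n → ℝ) → List (Set (Fin n → ℝ)) → Prop
  | 0, _, L => L = []
  | 1, σ, L => (∀ F, F ∈ L ↔ (IsFaceOf σ F ∧ faceDim F = 0)) ∧ L.Nodup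
  | (m+2), σ, L =>
      (∀ F, F ∈ L ↔ (IsFaceOf σ F ∧ faceDim F = m + 1)) ∧ L.Nodup ∧ L ≠ [] ∧
      (∃ K, IsShelling (m+1) (L.getD 0 ∅) K) ∧
      (∀ j, 1 ≤ j → j < L.length →
        ∃ K r, IsShelling (m+1) (L.getD j ∅) K ∧ 1 ≤ r ∧ r ≤ K.length ∧
          (L.getD j ∅) ∩ (⋃ i ∈ Finset.range j, L.getD i ∅) =
            ⋃ i ∈ Finset.range r, K.getD i ∅)

/-- The set `C` is cut out, inside its linear span, by the inequalities `0 ≤ u x` with `u ∈ U`. -/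
def IsCutOutBy {n : ℕ} (C : Set (Fin n → ℝ)) (U : Finset (Dual ℝ (Fin n → ℝ))) : Prop :=
  ∀ x, x ∈ C ↔ x ∈ Submodule.span ℝ C ∧ ∀ u ∈ U, 0 ≤ u x

/-- The part of `C` on which the functional `u` vanishes. -/
def wall {n : ℕ} (C : Set (Fin n → ℝ)) (u : Dual ℝ (Fin n → ℝ)) : Set (Fin n → ℝ) :=
  {x | x ∈ C ∧ u x = 0}

/-- An irredundant description of a cone by linear inequalities inside its linear span. -/
structure IsIrredundant {n : ℕ} (C : Set (Fin n → ℝ)) (U : Finset (Dual ℝ (Fin n → ℝ))) :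
    Prop where
  cutOut : IsCutOutBy C U
  exists_pos : ∃ p ∈ C, ∀ u ∈ U, 0 < u p
  exists_wall : ∀ u ∈ U, ∃ w ∈ C, u w = 0 ∧ ∀ v ∈ U, v ≠ u → 0 < v w

namespace IsCutOutBy

variable {n : ℕ} {C : Set (Fin n → ℝ)} {U : Finset (Dual ℝ (Fin n → ℝ))}

lemma nonneg (h : IsCutOutBy C U) {u : Dual ℝ (Fin n → ℝ)} (hu : u ∈ U) {x : Fin n → ℝ}
    (hx : x ∈ C) : 0 ≤ u x :=
  ((h x).1 hx).2 u hu

protected lemma zero_mem (h : IsCutOutBy C U) : 0 ∈ C :=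
  (h 0).2 ⟨zero_mem _, fun u _ => by simp⟩

protected lemma add_mem (h : IsCutOutBy C U) {x y : Fin n → ℝ} (hx : x ∈ C) (hy : y ∈ C) :
    x + y ∈ C := by
  refine (h _).2 ⟨add_mem (Submodule.subset_span hx) (Submodule.subset_span hy), fun u hu => ?_⟩
  rw [map_add]
  exact add_nonneg (h.nonneg hu hx) (h.nonneg hu hy)

protected lemma smul_mem (h : IsCutOutBy C U) {c : ℝ} (hc : 0 ≤ c) {x : Fin n → ℝ} (hx : x ∈ C) :
    c • x ∈ C := by
  refine (h _).2 ⟨Submodule.smul_mem _ _ (Submodule.subset_span hx), fun u hu => ?_⟩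
  rw [map_smul, smul_eq_mul]
  exact mul_nonneg hc (h.nonneg hu hx)

/-- Small steps from `x` in directions not leaving the inequalities tight at `x` stay in `C`. -/
lemma exists_add_smul_mem (h : IsCutOutBy C U) {x z : Fin n → ℝ} (hx : x ∈ C)
    (hz : z ∈ Submodule.span ℝ C) (hxz : ∀ u ∈ U, u x = 0 → 0 ≤ u z) :
    ∃ ε : ℝ, 0 < ε ∧ x + ε • z ∈ C := by
  have key : ∀ᶠ ε in nhdsWithin (0 : ℝ) (Set.Ioi 0), ∀ u ∈ U, 0 ≤ u x + ε * u z := by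
    rw [Filter.eventually_all_finset]
    intro u hu
    rcases (h.nonneg hu hx).eq_or_lt with h0 | h0
    · filter_upwards [self_mem_nhdsWithin] with ε hε
      rw [← h0, zero_add]
      exact mul_nonneg (le_of_lt hε) (hxz u hu h0.symm)
    · have hc : ContinuousAt (fun ε : ℝ => u x + ε * u z) 0 := by fun_prop
      have := hc.eventually_const_lt (u := 0) (by simpa using h0)
      exact (this.filter_mono nhdsWithin_le_nhds).mono fun _ => le_of_lt
  obtain ⟨ε, hε, hpos⟩ := (key.and self_mem_nhdsWithin).exists
  refine ⟨ε, hpos, (h _).2 ⟨add_mem (Submodule.subset_span hx) (Submodule.smul_mem _ _ hz), ?_⟩⟩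
  intro u hu
  simpa using hε u hu

/-- A cone has a point avoiding finitely many hyperplanes, none of which contains the cone. -/
lemma exists_forall_ne_zero (h : IsCutOutBy C U) (W : Finset (Dual ℝ (Fin n → ℝ)))
    (hW : ∀ w ∈ W, ∃ x ∈ C, w x ≠ 0) : ∃ p ∈ C, ∀ w ∈ W, w p ≠ 0 := by
  classical
  induction W using Finset.induction_on with
  | empty => exact ⟨0, h.zero_mem, by simp⟩
  | insert a s _ ih =>
    obtain ⟨p, hp, hps⟩ := ih fun w hw => hW w (Finset.mem_insert_of_mem hw)
    obtain ⟨q, hq, haq⟩ := hW a (Finset.mem_insert_self _ _)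
    have key : ∀ᶠ ε in nhdsWithin (0 : ℝ) (Set.Ioi 0), ∀ w ∈ insert a s, w p + ε * w q ≠ 0 := by
      rw [Filter.eventually_all_finset]
      intro w hw
      by_cases h0 : w p = 0
      · have hwa : w = a := by
          by_contra hne
          exact hps w ((Finset.mem_insert.1 hw).resolve_left hne) h0
        filter_upwards [self_mem_nhdsWithin] with ε hε
        rw [h0, zero_add, hwa]
        exact mul_ne_zero (ne_of_gt hε) haq
      · have hc : ContinuousAt (fun ε : ℝ => w p + ε * w q) 0 := by fun_prop
        exact (hc.eventually_ne (by simpa using h0)).filter_mono nhdsWithin_le_nhds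
    obtain ⟨ε, hε, hpos⟩ := (key.and self_mem_nhdsWithin).exists
    exact ⟨p + ε • q, h.add_mem hp (h.smul_mem (le_of_lt hpos) hq),
      fun w hw => by simpa using hε w hw⟩

/-- A cone has a point at which only those functionals vanish that vanish on the whole cone. -/
lemma exists_relint (h : IsCutOutBy C U) (W : Finset (Dual ℝ (Fin n → ℝ))) :
    ∃ p ∈ C, ∀ w ∈ W, w p = 0 → ∀ x ∈ C, w x = 0 := by
  classical
  obtain ⟨p, hp, hpW⟩ := h.exists_forall_ne_zero (W.filter fun w => ∃ x ∈ C, w x ≠ 0)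
    fun w hw => (Finset.mem_filter.1 hw).2
  refine ⟨p, hp, fun w hw h0 x hx => ?_⟩
  by_contra hne
  exact hpW w (Finset.mem_filter.2 ⟨hw, x, hx, hne⟩) h0

lemma of_forall_iff (h : ∀ x, x ∈ C ↔ ∀ u ∈ U, 0 ≤ u x) : IsCutOutBy C U :=
  fun x => ⟨fun hx => ⟨Submodule.subset_span hx, (h x).1 hx⟩, fun hx => (h x).2 hx.2⟩

lemma wall_erase [DecidableEq (Dual ℝ (Fin n → ℝ))] (h : IsCutOutBy C U)
    (u : Dual ℝ (Fin n → ℝ)) : IsCutOutBy (wall C u) (U.erase u) := by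
  intro x
  refine ⟨fun hx => ⟨Submodule.subset_span hx, fun v hv =>
    h.nonneg (Finset.mem_of_mem_erase hv) hx.1⟩, fun ⟨hx, hU⟩ => ?_⟩
  have hux : u x = 0 := by
    have : Submodule.span ℝ (wall C u) ≤ LinearMap.ker u := Submodule.span_le.2 fun y hy => hy.2
    exact this hx
  refine ⟨(h x).2 ⟨Submodule.span_mono (fun y hy => hy.1) hx, fun v hv => ?_⟩, hux⟩
  by_cases hvu : v = u
  · rw [hvu, hux]
  · exact hU v (Finset.mem_erase.2 ⟨hvu, hv⟩)

lemma exists_isIrredundant (h : IsCutOutBy C U) : ∃ U' ⊆ U, IsIrredundant C U' := by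
  classical
  induction U using Finset.strongInduction with
  | H U ih =>
    by_cases hred : ∃ u ∈ U, IsCutOutBy C (U.erase u)
    · obtain ⟨u, hu, hcut⟩ := hred
      obtain ⟨U', hU', hirr⟩ := ih _ (Finset.erase_ssubset hu) hcut
      exact ⟨U', hU'.trans (Finset.erase_subset _ _), hirr⟩
    push Not at hred
    have hneg : ∀ u ∈ U, ∃ z ∈ Submodule.span ℝ C, u z < 0 ∧ ∀ v ∈ U, v ≠ u → 0 ≤ v z := by
      intro u hu
      by_contra hcon
      push Not at hcon
      refine hred u hu fun x => ⟨fun hx => ⟨Submodule.subset_span hx, fun v hv =>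
        h.nonneg (Finset.mem_of_mem_erase hv) hx⟩, fun ⟨hx, hU⟩ => (h x).2 ⟨hx, fun v hv => ?_⟩⟩
      by_cases hvu : v = u
      · subst hvu
        by_contra hlt
        obtain ⟨v', hv', hne, hlt'⟩ := hcon x hx (not_le.1 hlt)
        exact absurd (hU v' (Finset.mem_erase.2 ⟨hne, hv'⟩)) (not_le.2 hlt')
      · exact hU v (Finset.mem_erase.2 ⟨hvu, hv⟩)
    obtain ⟨p, hp, hpU⟩ := h.exists_relint U
    have hpos : ∀ u ∈ U, 0 < u p := by
      intro u hu
      refine lt_of_le_of_ne (h.nonneg hu hp) fun h0 => ?_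
      have hker : Submodule.span ℝ C ≤ LinearMap.ker u :=
        Submodule.span_le.2 fun x hx => hpU u hu h0.symm x hx
      obtain ⟨z, hz, hlt, -⟩ := hneg u hu
      exact hlt.ne (hker hz)
    refine ⟨U, subset_rfl, h, ⟨p, hp, hpos⟩, fun u hu => ?_⟩
    obtain ⟨z, hz, hlt, hv⟩ := hneg u hu
    have hwu : u (u p • z + (-u z) • p) = 0 := by
      simp only [map_add, map_smul, smul_eq_mul]
      ring
    have hwv : ∀ v ∈ U, v ≠ u → 0 < v (u p • z + (-u z) • p) := by
      intro v hvU hvu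
      simp only [map_add, map_smul, smul_eq_mul]
      have h1 := mul_nonneg (hpos u hu).le (hv v hvU hvu)
      have h2 := mul_pos (neg_pos.2 hlt) (hpos v hvU)
      linarith
    refine ⟨_, (h _).2 ⟨add_mem (Submodule.smul_mem _ _ hz)
      (Submodule.smul_mem _ _ (Submodule.subset_span hp)), fun v hvU => ?_⟩, hwu, hwv⟩
    by_cases hvu : v = u
    · rw [hvu, hwu]
    · exact (hwv v hvU hvu).le

end IsCutOutBy

lemma finrank_inf_ker_add_one {n : ℕ} (V : Submodule ℝ (Fin n → ℝ)) (u : Dual ℝ (Fin n → ℝ))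
    {p : Fin n → ℝ} (hp : p ∈ V) (hup : u p ≠ 0) :
    finrank ℝ ↥(V ⊓ LinearMap.ker u) + 1 = finrank ℝ V := by
  have hrange : LinearMap.range (u.domRestrict V) = ⊤ := by
    refine LinearMap.range_eq_top.2 (LinearMap.surjective fun h0 => hup ?_)
    simpa using LinearMap.congr_fun h0 ⟨p, hp⟩
  have hrank := LinearMap.finrank_range_add_finrank_ker (u.domRestrict V)
  rw [hrange, finrank_top, finrank_self] at hrank
  have hker : finrank ℝ ↥(LinearMap.ker (u.domRestrict V)) =
      finrank ℝ ↥(V ⊓ LinearMap.ker u) := by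
    have hmap : (LinearMap.ker (u.domRestrict V)).map V.subtype = V ⊓ LinearMap.ker u := by
      ext x
      simp [and_comm]
    rw [← hmap, Submodule.finrank_map_subtype_eq]
  omega

namespace IsIrredundant

variable {n : ℕ} {C : Set (Fin n → ℝ)} {U : Finset (Dual ℝ (Fin n → ℝ))}

lemma wall_injOn (h : IsIrredundant C U) : Set.InjOn (wall C) U := by
  intro u hu v hv huv
  by_contra hne
  obtain ⟨w, hw, hw0, hpos⟩ := h.exists_wall u hu
  have : w ∈ wall C v := huv ▸ ⟨hw, hw0⟩
  exact (hpos v hv (Ne.symm hne)).ne' this.2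

lemma span_wall (h : IsIrredundant C U) {u : Dual ℝ (Fin n → ℝ)} (hu : u ∈ U) :
    Submodule.span ℝ (wall C u) = Submodule.span ℝ C ⊓ LinearMap.ker u := by
  refine le_antisymm (Submodule.span_le.2 fun x hx => ⟨Submodule.subset_span hx.1, hx.2⟩) ?_
  rintro z ⟨hz, hzu⟩
  have hzu : u z = 0 := hzu
  obtain ⟨w, hw, hw0, hpos⟩ := h.exists_wall u hu
  obtain ⟨ε, hε, hmem⟩ := h.cutOut.exists_add_smul_mem hw hz fun v hv hvw => by
    by_cases hvu : v = u
    · rw [hvu, hzu]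
    · exact absurd hvw (hpos v hv hvu).ne'
  have h1 : w ∈ Submodule.span ℝ (wall C u) := Submodule.subset_span ⟨hw, hw0⟩
  have h2 : w + ε • z ∈ Submodule.span ℝ (wall C u) :=
    Submodule.subset_span ⟨hmem, by simp [hw0, hzu]⟩
  have h3 := Submodule.sub_mem _ h2 h1
  rw [add_sub_cancel_left] at h3
  exact (Submodule.smul_mem_iff _ hε.ne').1 h3

lemma faceDim_wall (h : IsIrredundant C U) {u : Dual ℝ (Fin n → ℝ)} (hu : u ∈ U) :
    faceDim (wall C u) + 1 = faceDim C := by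
  obtain ⟨p, hp, hpos⟩ := h.exists_pos
  rw [faceDim, h.span_wall hu]
  exact finrank_inf_ker_add_one _ u (Submodule.subset_span hp) (hpos u hu).ne'

lemma exists_eq_wall (h : IsIrredundant C U) {F : Set (Fin n → ℝ)} (hF : IsFaceOf C F)
    (hdim : faceDim F + 1 = faceDim C) : ∃ u ∈ U, F = wall C u := by
  classical
  obtain ⟨v, hv, rfl⟩ := hF
  obtain ⟨x, hx, hxU⟩ := (h.cutOut.wall_erase v).exists_relint U
  obtain ⟨q, hq, hvq⟩ : ∃ q ∈ C, v q ≠ 0 := by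
    by_contra! hcon
    have : {x | x ∈ C ∧ v x = 0} = C := by
      ext y
      exact ⟨fun hy => hy.1, fun hy => ⟨hy, hcon y hy⟩⟩
    rw [this] at hdim
    omega
  obtain ⟨u, hu, hux⟩ : ∃ u ∈ U, u x = 0 := by
    by_contra! hcon
    obtain ⟨ε, hε, hmem⟩ := h.cutOut.exists_add_smul_mem (z := -q) hx.1
      (neg_mem (Submodule.subset_span hq)) fun u hu h0 => absurd h0 (hcon u hu)
    have h1 := hv _ hmem
    have h2 := mul_pos hε ((hv q hq).lt_of_ne' hvq)
    simp only [map_add, map_smul, map_neg, smul_eq_mul, hx.2] at h1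
    linarith
  have hsub : wall C v ⊆ wall C u := fun y hy => ⟨hy.1, hxU u hu hux y hy⟩
  have hspan : Submodule.span ℝ (wall C v) = Submodule.span ℝ (wall C u) := by
    refine Submodule.eq_of_le_of_finrank_eq (Submodule.span_mono hsub) ?_
    have h1 := h.faceDim_wall hu
    exact Nat.succ_injective (hdim.trans h1.symm)
  refine ⟨u, hu, hsub.antisymm fun y hy => ⟨hy.1, ?_⟩⟩
  have hle : Submodule.span ℝ (wall C v) ≤ LinearMap.ker v := Submodule.span_le.2 fun y hy => hy.2
  exact hle (hspan ▸ Submodule.subset_span hy)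

lemma isFaceOf_wall (h : IsIrredundant C U) {u : Dual ℝ (Fin n → ℝ)} (hu : u ∈ U) :
    IsFaceOf C (wall C u) :=
  ⟨u, fun _ hx => h.cutOut.nonneg hu hx, rfl⟩

/-- The facets of a cone are the walls of an irredundant description. -/
lemma mem_map_wall_iff (h : IsIrredundant C U) {L : List (Dual ℝ (Fin n → ℝ))}
    (hL : ∀ u, u ∈ L ↔ u ∈ U) {d : ℕ} (hd : faceDim C = d + 1) (F : Set (Fin n → ℝ)) :
    F ∈ L.map (wall C) ↔ IsFaceOf C F ∧ faceDim F = d := by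
  rw [List.mem_map]
  constructor
  · rintro ⟨u, hu, rfl⟩
    have hu := (hL u).1 hu
    have := h.faceDim_wall hu
    exact ⟨h.isFaceOf_wall hu, by omega⟩
  · rintro ⟨hF, hdim⟩
    obtain ⟨u, hu, rfl⟩ := h.exists_eq_wall hF (by omega)
    exact ⟨u, (hL u).2 hu, rfl⟩

lemma nodup_map_wall (h : IsIrredundant C U) {L : List (Dual ℝ (Fin n → ℝ))}
    (hL : ∀ u, u ∈ L ↔ u ∈ U) (hnd : L.Nodup) : (L.map (wall C)).Nodup :=
  hnd.map_on fun u hu v hv => h.wall_injOn ((hL u).1 hu) ((hL v).1 hv)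

lemma nonempty (h : IsIrredundant C U) (hsc : IsStronglyConvex C) (hdim : faceDim C ≠ 0) :
    U.Nonempty := by
  rw [Finset.nonempty_iff_ne_empty]
  rintro rfl
  refine hdim ?_
  have hbot : Submodule.span ℝ C = ⊥ := by
    refine (Submodule.eq_bot_iff _).2 fun x hx => hsc x ?_ ?_
    · exact (h.cutOut x).2 ⟨hx, by simp⟩
    · exact (h.cutOut _).2 ⟨neg_mem hx, by simp⟩
  rw [faceDim, hbot, finrank_bot]

/-- If a functional nonnegative on `C` vanishes at `x` and is negative at `y`, then `y` lies on the
negative side of some wall through `x`. -/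
lemma exists_visible (h : IsIrredundant C U) {x y : Fin n → ℝ} (hx : x ∈ C)
    (hy : y ∈ Submodule.span ℝ C) {v : Dual ℝ (Fin n → ℝ)} (hv : ∀ z ∈ C, 0 ≤ v z)
    (hvx : v x = 0) (hvy : v y < 0) : ∃ u ∈ U, u x = 0 ∧ u y < 0 := by
  by_contra! hcon
  obtain ⟨ε, hε, hmem⟩ := h.cutOut.exists_add_smul_mem hx hy hcon
  have h1 := hv _ hmem
  have h2 := mul_neg_of_pos_of_neg hε hvy
  simp only [map_add, map_smul, smul_eq_mul, hvx] at h1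
  linarith

/-- For `y` off all walls, there is a point `p` inside the cone such that the line through `p` in
direction `y` meets the walls at distinct parameters. -/
lemma exists_generic (h : IsIrredundant C U) {y : Fin n → ℝ} (hy : ∀ u ∈ U, u y ≠ 0) :
    ∃ p ∈ C, (∀ u ∈ U, 0 < u p) ∧ Set.InjOn (fun u : Dual ℝ (Fin n → ℝ) => u y / u p) U := by
  classical
  obtain ⟨q, hq, hqpos⟩ := h.exists_pos
  obtain ⟨p, hp, hpW⟩ := h.cutOut.exists_forall_ne_zero
    (U ∪ U.offDiag.image fun z => z.1 y • z.2 - z.2 y • z.1) (by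
      intro w hw
      rcases Finset.mem_union.1 hw with hw | hw
      · exact ⟨q, hq, (hqpos w hw).ne'⟩
      · obtain ⟨⟨u, v⟩, huv, rfl⟩ := Finset.mem_image.1 hw
        obtain ⟨hu, hv, hne⟩ := Finset.mem_offDiag.1 huv
        obtain ⟨x, hx, hux, hpos⟩ := h.exists_wall u hu
        refine ⟨x, hx, ?_⟩
        simpa [hux] using ⟨hy u hu, (hpos v hv (Ne.symm hne)).ne'⟩)
  have hpos : ∀ u ∈ U, 0 < u p := fun u hu =>
    (h.cutOut.nonneg hu hp).lt_of_ne' (hpW u (Finset.mem_union_left _ hu))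
  refine ⟨p, hp, hpos, fun u hu v hv huv => ?_⟩
  by_contra hne
  refine hpW (u y • v - v y • u) (Finset.mem_union_right _ (Finset.mem_image.2
    ⟨(u, v), Finset.mem_offDiag.2 ⟨hu, hv, hne⟩, rfl⟩)) ?_
  have := (div_eq_div_iff (hpos u hu).ne' (hpos v hv).ne').1 huv
  simp only [LinearMap.sub_apply, LinearMap.smul_apply, smul_eq_mul]
  linarith

end IsIrredundant

lemma Finset.exists_list_pairwise_lt {α : Type*} (s : Finset α) {f : α → ℝ}
    (hf : Set.InjOn f s) :
    ∃ L : List α, L.Nodup ∧ (∀ a, a ∈ L ↔ a ∈ s) ∧ L.Pairwise fun a b => f a < f b := by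
  classical
  induction s using Finset.induction_on_max_value f with
  | empty => exact ⟨[], by simp⟩
  | insert a s ha hmax ih =>
    obtain ⟨L, hnd, hmem, hL⟩ := ih (hf.mono (by simp))
    refine ⟨L ++ [a], ?_, fun b => by simp [hmem, or_comm], ?_⟩
    · rw [List.nodup_append]
      refine ⟨hnd, by simp, fun b hb c hc hbc => ha ?_⟩
      rw [← List.mem_singleton.1 hc, ← hbc]
      exact (hmem b).1 hb
    · rw [List.pairwise_append]
      refine ⟨hL, by simp, fun b hb c hc => ?_⟩
      rw [List.mem_singleton.1 hc]
      have hb := (hmem b).1 hb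
      refine lt_of_le_of_ne (hmax b hb) fun hba => ha ?_
      rw [← hf (by simp [hb]) (by simp) hba]
      exact hb

lemma List.exists_append_of_pairwise {α : Type*} {p : α → Prop} {L : List α}
    (h : L.Pairwise fun a b => p b → p a) :
    ∃ L₁ L₂, L = L₁ ++ L₂ ∧ (∀ a ∈ L₁, p a) ∧ ∀ a ∈ L₂, ¬ p a := by
  induction L with
  | nil => exact ⟨[], [], by simp⟩
  | cons a l ih =>
    rw [List.pairwise_cons] at h
    by_cases ha : p a
    · obtain ⟨L₁, L₂, rfl, h₁, h₂⟩ := ih h.2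
      exact ⟨a :: L₁, L₂, rfl, by simpa [ha] using h₁, h₂⟩
    · exact ⟨[], a :: l, rfl, by simp, by
        simpa [ha] using fun b hb hpb => ha (h.1 b hb hpb)⟩

lemma pairwise_neg_of_pairwise_div_lt {α : Type*} {f g : α → ℝ} {L : List α}
    (hg : ∀ a ∈ L, 0 < g a) (h : L.Pairwise fun a b => f a / g a < f b / g b) :
    L.Pairwise fun a b => f b < 0 → f a < 0 := by
  refine h.imp_of_mem fun {a b} ha hb hab hfb => ?_
  simpa using (div_lt_iff₀ (hg a ha)).1 (hab.trans (div_neg_of_neg_of_pos hfb (hg b hb)))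

/-- Line shelling: ordering the walls of a cone along a generic line in direction `y` gives a
shelling in which the walls having `y` on their negative side come first. -/
lemma exists_isShelling_map_wall {n : ℕ} (d : ℕ) (C : Set (Fin n → ℝ))
    (U : Finset (Dual ℝ (Fin n → ℝ))) (h : IsIrredundant C U) (hsc : IsStronglyConvex C)
    (hdim : faceDim C = d + 1) (y : Fin n → ℝ) (hyC : y ∈ Submodule.span ℝ C)
    (hy : ∀ u ∈ U, u y ≠ 0) :
    ∃ L : List (Dual ℝ (Fin n → ℝ)), (∀ u, u ∈ L ↔ u ∈ U) ∧
      L.Pairwise (fun u v => v y < 0 → u y < 0) ∧ IsShelling (d + 1) C (L.map (wall C)) := by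
  classical
  induction d generalizing C U y with
  | zero =>
    obtain ⟨p, -, hpos, hinj⟩ := h.exists_generic hy
    obtain ⟨L, hnd, hmem, hlt⟩ := U.exists_list_pairwise_lt hinj
    exact ⟨L, hmem, pairwise_neg_of_pairwise_div_lt (fun u hu => hpos u ((hmem u).1 hu)) hlt,
      h.mem_map_wall_iff hmem hdim, h.nodup_map_wall hmem hnd⟩
  | succ m ih =>
    obtain ⟨p, hpC, hpos, hinj⟩ := h.exists_generic hy
    obtain ⟨L, hnd, hmem, hlt⟩ := U.exists_list_pairwise_lt hinj
    have hscw : ∀ u, IsStronglyConvex (wall C u) := fun u x hx hnx => hsc x hx.1 hnx.1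
    have hdimw : ∀ u ∈ U, faceDim (wall C u) = m + 1 := fun u hu => by
      have := h.faceDim_wall hu
      omega
    have hne : L ≠ [] := by
      obtain ⟨u, hu⟩ := h.nonempty hsc (by omega)
      exact List.ne_nil_of_mem ((hmem u).2 hu)
    refine ⟨L, hmem, pairwise_neg_of_pairwise_div_lt (fun u hu => hpos u ((hmem u).1 hu)) hlt,
      h.mem_map_wall_iff hmem hdim, h.nodup_map_wall hmem hnd, by simpa using hne, ?_, ?_⟩
    · have hlen : 0 < L.length := List.length_pos_iff.2 hne
      have hget : (L.map (wall C)).getD 0 ∅ = wall C L[0] := by simp [hlen]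
      have hu : L[0] ∈ U := (hmem _).1 (List.getElem_mem hlen)
      obtain ⟨U', -, hU'⟩ := (h.cutOut.wall_erase L[0]).exists_isIrredundant
      obtain ⟨q, hq, hqpos⟩ := hU'.exists_pos
      obtain ⟨K, -, -, hK⟩ := ih _ U' hU' (hscw _) (hdimw _ hu) q (Submodule.subset_span hq)
        fun u hu => (hqpos u hu).ne'
      exact ⟨_, hget ▸ hK⟩
    · intro j hj1 hj
      have hj : j < L.length := by simpa using hj
      have hget : ∀ i (hi : i < L.length), (L.map (wall C)).getD i ∅ = wall C L[i] := by
        intro i hi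
        simp [hi]
      have hLU : ∀ i (hi : i < L.length), L[i] ∈ U := fun i hi =>
        (hmem _).1 (List.getElem_mem hi)
      obtain ⟨U', hsub, hU'⟩ := (h.cutOut.wall_erase L[j]).exists_isIrredundant
      set w := L[j] with hw
      have hwU : w ∈ U := hLU j hj
      have hz : ∀ u ∈ U, u (y - (w y / w p) • p) = u p * (u y / u p - w y / w p) := by
        intro u hu
        have := (hpos u hu).ne'
        simp only [map_sub, map_smul, smul_eq_mul]
        field_simp
      set z := y - (w y / w p) • p with hzdef
      have hzspan : z ∈ Submodule.span ℝ (wall C w) := by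
        rw [h.span_wall hwU]
        refine ⟨sub_mem hyC (Submodule.smul_mem _ _ (Submodule.subset_span hpC)), ?_⟩
        change w z = 0
        rw [hz w hwU, sub_self, mul_zero]
      have hz_neg : ∀ u ∈ U, u z < 0 ↔ u y / u p < w y / w p := by
        intro u hu
        rw [hz u hu, ← smul_eq_mul, smul_neg_iff_of_pos_left (hpos u hu), sub_neg]
      obtain ⟨K, hKmem, hKsort, hK⟩ := ih _ U' hU' (hscw _) (hdimw _ hwU) z hzspan (by
        intro u hu
        obtain ⟨hne, huU⟩ := Finset.mem_erase.1 (hsub hu)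
        rw [hz u huU]
        exact mul_ne_zero (hpos u huU).ne' (sub_ne_zero.2 fun heq => hne (hinj huU hwU heq)))
      obtain ⟨K₁, K₂, rfl, hK₁, hK₂⟩ := List.exists_append_of_pairwise hKsort
      have hvis : ∀ i (hij : i < j), ∀ x ∈ wall C w, x ∈ wall C (L[i]'(hij.trans hj)) →
          ∃ v ∈ K₁, x ∈ wall (wall C w) v := by
        intro i hij x hxw hxi
        have hiU := hLU i (hij.trans hj)
        obtain ⟨v, hv, hvx, hvz⟩ := hU'.exists_visible hxw hzspan
          (fun a ha => h.cutOut.nonneg hiU ha.1) hxi.2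
          ((hz_neg _ hiU).2 (List.pairwise_iff_getElem.1 hlt i j _ hj hij))
        refine ⟨v, ?_, hxw, hvx⟩
        exact (List.mem_append.1 ((hKmem v).2 hv)).resolve_right fun hv2 => hK₂ v hv2 hvz
      have hgetK : ∀ k (hk : k < K₁.length),
          ((K₁ ++ K₂).map (wall (wall C w))).getD k ∅ = wall (wall C w) K₁[k] := by
        intro k hk
        rw [List.getD_eq_getElem _ _ (by simp; omega), List.getElem_map,
          List.getElem_append_left hk]
      refine ⟨_, K₁.length, hget j hj ▸ hK, ?_, by simp, ?_⟩
      · have hzero : ∀ u, (0 : Fin n → ℝ) ∈ wall C u := fun u => ⟨h.cutOut.zero_mem, map_zero u⟩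
        obtain ⟨v, hv, -⟩ := hvis 0 hj1 0 (hzero _) (hzero _)
        exact List.length_pos_of_mem hv
      · rw [hget j hj]
        ext x
        simp only [Set.mem_inter_iff, Set.mem_iUnion, Finset.mem_range, exists_prop]
        constructor
        · rintro ⟨hxw, i, hij, hxi⟩
          rw [hget i (hij.trans hj)] at hxi
          obtain ⟨v, hv, hxv⟩ := hvis i hij x hxw hxi
          obtain ⟨k, hk, rfl⟩ := List.getElem_of_mem hv
          exact ⟨k, hk, (hgetK k hk).symm ▸ hxv⟩
        · rintro ⟨k, hk, hxk⟩
          rw [hgetK k hk] at hxk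
          have hvU : K₁[k] ∈ U := Finset.mem_of_mem_erase (hsub ((hKmem _).1
            (List.mem_append_left _ (List.getElem_mem hk))))
          have hvlt := (hz_neg _ hvU).1 (hK₁ _ (List.getElem_mem hk))
          obtain ⟨i, hi, hiv⟩ := List.getElem_of_mem ((hmem _).2 hvU)
          have hij : i < j := by
            by_contra! hji
            rcases hji.eq_or_lt with rfl | hji
            · rw [← hiv] at hvlt
              exact lt_irrefl _ hvlt
            · have := List.pairwise_iff_getElem.1 hlt j i hj hi hji
              rw [hiv] at this
              exact lt_asymm this hvlt
          refine ⟨hxk.1, i, hij, ?_⟩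
          rw [hget i hi, hiv]
          exact ⟨hxk.1.1, hxk.2⟩

/-- Fourier–Motzkin elimination: adding a ray to a cone cut out by finitely many linear
inequalities gives a cone of the same kind. -/
lemma exists_add_ray_iff {n : ℕ} (I : Finset (Dual ℝ (Fin n → ℝ))) (s : Fin n → ℝ) :
    ∃ J : Finset (Dual ℝ (Fin n → ℝ)), ∀ x,
      (∃ c : ℝ, 0 ≤ c ∧ ∀ u ∈ I, 0 ≤ u (x - c • s)) ↔ ∀ u ∈ J, 0 ≤ u x := by
  classical
  refine ⟨I.filter (fun u => 0 ≤ u s) ∪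
    ((I.filter fun u => 0 < u s) ×ˢ (I.filter fun u => u s < 0)).image
      (fun z => z.1 s • z.2 - z.2 s • z.1), fun x => ⟨?_, fun hJ => ?_⟩⟩
  · rintro ⟨c, hc, hI⟩ u hu
    have hI : ∀ u ∈ I, c * u s ≤ u x := fun u hu => by simpa using hI u hu
    rcases Finset.mem_union.1 hu with hu | hu
    · obtain ⟨hu, hus⟩ := Finset.mem_filter.1 hu
      exact (mul_nonneg hc hus).trans (hI u hu)
    · obtain ⟨⟨v, w⟩, hvw, rfl⟩ := Finset.mem_image.1 hu
      simp only [Finset.mem_product, Finset.mem_filter] at hvw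
      obtain ⟨⟨hv, hvs⟩, hw, hws⟩ := hvw
      simp only [LinearMap.sub_apply, LinearMap.smul_apply, smul_eq_mul]
      nlinarith [hI v hv, hI w hw]
  · have hnonneg : ∀ u ∈ I, 0 ≤ u s → 0 ≤ u x := fun u hu hus =>
      hJ u (Finset.mem_union_left _ (Finset.mem_filter.2 ⟨hu, hus⟩))
    have hpair : ∀ v ∈ I, ∀ w ∈ I, 0 < v s → w s < 0 → w x / w s ≤ v x / v s := by
      intro v hv w hw hvs hws
      have := hJ (v s • w - w s • v) (Finset.mem_union_right _ (Finset.mem_image.2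
        ⟨(v, w), by simp [hv, hw, hvs, hws], rfl⟩))
      simp only [LinearMap.sub_apply, LinearMap.smul_apply, smul_eq_mul] at this
      rw [div_le_iff_of_neg hws, div_mul_eq_mul_div, div_le_iff₀ hvs]
      linarith
    let T := insert 0 ((I.filter fun u => u s < 0).image fun u => u x / u s)
    have hT : T.Nonempty := Finset.insert_nonempty _ _
    refine ⟨T.max' hT, T.le_max' _ (Finset.mem_insert_self _ _), fun u hu => ?_⟩
    simp only [map_sub, map_smul, smul_eq_mul, sub_nonneg]
    rcases lt_trichotomy (u s) 0 with hus | hus | hus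
    · have := T.le_max' (u x / u s) (Finset.mem_insert_of_mem (Finset.mem_image.2
        ⟨u, Finset.mem_filter.2 ⟨hu, hus⟩, rfl⟩))
      exact (div_le_iff_of_neg hus).1 this
    · rw [hus, mul_zero]
      exact hnonneg u hu hus.ge
    · rw [← le_div_iff₀ hus]
      refine T.max'_le hT _ fun t ht => ?_
      rcases Finset.mem_insert.1 ht with rfl | ht
      · exact div_nonneg (hnonneg u hu hus.le) hus.le
      · obtain ⟨w, hw, rfl⟩ := Finset.mem_image.1 ht
        obtain ⟨hw, hws⟩ := Finset.mem_filter.1 hw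
        exact hpair u hu w hw hus hws

/-- Minkowski–Weyl: a finitely generated cone is cut out by finitely many linear inequalities. -/
lemma exists_mem_cone_iff {n : ℕ} {ι : Type*} (S : Finset ι) (g : ι → Fin n → ℝ) :
    ∃ I : Finset (Dual ℝ (Fin n → ℝ)), ∀ x,
      (∃ c : ι → ℝ, (∀ s, 0 ≤ c s) ∧ x = ∑ s ∈ S, c s • g s) ↔ ∀ u ∈ I, 0 ≤ u x := by
  classical
  induction S using Finset.induction_on with
  | empty =>
    refine ⟨Finset.univ.image (fun i => LinearMap.proj i) ∪
      Finset.univ.image (fun i => -LinearMap.proj i), fun x => ⟨?_, fun hx => ?_⟩⟩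
    · rintro ⟨c, -, rfl⟩ u -
      simp
    · refine ⟨0, fun _ => le_rfl, ?_⟩
      rw [Finset.sum_empty]
      ext i
      have h1 := hx (LinearMap.proj i) (by simp)
      have h2 := hx (-LinearMap.proj i) (by simp)
      simp only [LinearMap.neg_apply, LinearMap.proj_apply] at h1 h2
      exact le_antisymm (neg_nonneg.1 h2) h1
  | insert a s ha ih =>
    obtain ⟨I, hI⟩ := ih
    obtain ⟨J, hJ⟩ := exists_add_ray_iff I (g a)
    refine ⟨J, fun x => ?_⟩
    rw [← hJ]
    simp_rw [← hI]
    constructor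
    · rintro ⟨c, hc, rfl⟩
      exact ⟨c a, hc a, c, hc, by rw [Finset.sum_insert ha, add_sub_cancel_left]⟩
    · rintro ⟨t, ht, c, hc, hx⟩
      refine ⟨Function.update c a t, fun i => ?_, ?_⟩
      · by_cases hi : i = a
        · simpa [hi] using ht
        · simpa [hi] using hc i
      · rw [Finset.sum_insert ha, Function.update_self, sub_eq_iff_eq_add'.1 hx]
        congr 1
        refine Finset.sum_congr rfl fun i hi => ?_
        rw [Function.update_of_ne (ne_of_mem_of_not_mem hi ha)]

/-- (Bruggesser–Mani) Every strongly convex full-dimensional (rational)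
polyhedral cone is shellable: there is a linear ordering of its facets satisfying the
recursive shelling conditions. -/
theorem stmt_17 {n : ℕ} (hn : 1 ≤ n) (σ : Set (Fin n → ℝ))
    (hpoly : IsRatPolyhedralCone σ) (hsc : IsStronglyConvex σ) (hfull : faceDim σ = n) :
    ∃ L : List (Set (Fin n → ℝ)), IsShelling n σ L := by
  obtain ⟨d, rfl⟩ := Nat.exists_eq_succ_of_ne_zero (Nat.one_le_iff_ne_zero.1 hn)
  obtain ⟨S, rfl⟩ := hpoly
  obtain ⟨I, hI⟩ := exists_mem_cone_iff S fun s i => ((s i : ℤ) : ℝ)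
  obtain ⟨U, -, hU⟩ := (IsCutOutBy.of_forall_iff hI).exists_isIrredundant
  obtain ⟨p, hp, hpos⟩ := hU.exists_pos
  obtain ⟨L, -, -, hL⟩ := exists_isShelling_map_wall d _ U hU hsc hfull p
    (Submodule.subset_span hp) fun u hu => (hpos u hu).ne'
  exact ⟨_, hL⟩
end
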